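/- arXiv:2601.20414 — 8 statements merged into one kernel-verified Lean document; each statement's English description precedes it below -/
import Mathlib

section
/- Let (X, d) be a separable metric space and let f be a gauge function that is continuous and doubling, i.e. there exists r > 0 such that f(2x) < r·f(x) for all x ∈ [0, ∞) with x > 0. Then the pair (X, f) satisfies Assumption(*): there exist a constant α > 1 and a countable family 𝒞 of subsets of X such that for every subset A ⊆ X of finite diameter and every ε > 0 there is C ∈ 𝒞 with A ⊆ C and f(diam(C)) ≤ ε + α·f(diam(A)). -/
open Set

/-- A gauge function: `f : [0, ∞) → [0, ∞)` nondecreasing, right-continuous, with `f 0 = 0`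
(formalized as a real function, with all conditions imposed on `[0, ∞)`). -/
structure IsGauge (f : ℝ → ℝ) : Prop where
  map_zero : f 0 = 0
  nonneg : ∀ x : ℝ, 0 ≤ x → 0 ≤ f x
  mono : ∀ ⦃x y : ℝ⦄, 0 ≤ x → x ≤ y → f x ≤ f y
  rightCont : ∀ x : ℝ, 0 ≤ x → ContinuousWithinAt f (Set.Ici x) x

/-- Assumption(*) for a metric space `X` and a gauge function `f`: there exist a constant
`α > 1` and a countable family `𝒞` of subsets of `X` such that every set `A` of finite
diameter is, for every `ε > 0`, contained in some `C ∈ 𝒞` with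
`f (diam C) ≤ ε + α · f (diam A)`. -/
def AssumptionStar {X : Type*} [MetricSpace X] (f : ℝ → ℝ) : Prop :=
  ∃ α : ℝ, 1 < α ∧ ∃ 𝒞 : Set (Set X), 𝒞.Countable ∧
    ∀ A : Set X, EMetric.diam A ≠ ⊤ → ∀ ε : ℝ, 0 < ε →
      ∃ C ∈ 𝒞, A ⊆ C ∧ EMetric.diam C ≠ ⊤ ∧
        f (EMetric.diam C).toReal ≤ ε + α * f (EMetric.diam A).toReal

/-- If `(X, d)` is a separable metric space and `f` is a continuous doubling
gauge function (there is `r > 0` with `f (2x) < r · f x` for all `x > 0`), then `(X, f)`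
satisfies Assumption(*). -/
theorem statement2 {X : Type*} [MetricSpace X] [TopologicalSpace.SeparableSpace X]
    (f : ℝ → ℝ) (hf : IsGauge f) (hcont : ContinuousOn f (Set.Ici 0))
    (hdoubling : ∃ r : ℝ, 0 < r ∧ ∀ x : ℝ, 0 < x → f (2 * x) < r * f x) :
    AssumptionStar (X := X) f := by
  obtain ⟨r, hr, hd⟩ := hdoubling
  refine ⟨max r 2, lt_of_lt_of_le one_lt_two (le_max_right _ _), ?_⟩
  obtain ⟨S, hSc, hSd⟩ := TopologicalSpace.exists_countable_dense X
  refine ⟨insert ∅ ((fun p : X × ℚ => Metric.closedBall p.1 (p.2 : ℝ)) '' (S ×ˢ Set.univ)),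
    ((hSc.prod Set.countable_univ).image _).insert _, ?_⟩
  intro A hA ε hε
  rcases A.eq_empty_or_nonempty with rfl | ⟨a, ha⟩
  · refine ⟨∅, Set.mem_insert _ _, subset_rfl, hA, ?_⟩
    have h0 : (EMetric.diam (∅ : Set X)).toReal = 0 := Metric.diam_empty
    rw [h0, hf.map_zero]
    simpa using hε.le
  set D := (EMetric.diam A).toReal with hD
  have hD0 : 0 ≤ D := ENNReal.toReal_nonneg
  have hfD : 0 ≤ f D := hf.nonneg D hD0
  have h2 : f (2 * D) ≤ max r 2 * f D := by
    rcases hD0.eq_or_lt with h | h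
    · rw [← h]; simp [hf.map_zero]
    · exact (hd D h).le.trans (mul_le_mul_of_nonneg_right (le_max_left _ _) hfD)
  obtain ⟨δ, hδ, hδf⟩ := Metric.continuousWithinAt_iff.1
    (hf.rightCont (2 * D) (by positivity)) ε hε
  obtain ⟨x, hxS, hx⟩ := hSd.exists_dist_lt a (show 0 < δ / 8 by positivity)
  obtain ⟨q, hq1, hq2⟩ := exists_rat_btwn (show D + δ / 8 < D + δ / 4 by linarith)
  have hdist : ∀ y ∈ A, dist y a ≤ D := fun y hy => by
    rw [dist_edist]
    exact ENNReal.toReal_mono hA (EMetric.edist_le_diam_of_mem hy ha)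
  have hq0 : (0 : ℝ) ≤ q := by linarith
  have hb : Bornology.IsBounded (Metric.closedBall x (q : ℝ)) := Metric.isBounded_closedBall
  refine ⟨Metric.closedBall x q, Or.inr ⟨(x, q), ⟨hxS, trivial⟩, rfl⟩, ?_, ?_, ?_⟩
  · intro y hy
    rw [Metric.mem_closedBall]
    have := dist_triangle y a x
    have := hdist y hy
    linarith
  · exact hb.ediam_ne_top
  · have h3 : (EMetric.diam (Metric.closedBall x (q : ℝ))).toReal ≤ 2 * q :=
      Metric.diam_closedBall hq0
    have h4 := hf.mono ENNReal.toReal_nonneg h3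
    have h5 := hδf (x := 2 * (q : ℝ)) (by simp only [Set.mem_Ici]; linarith)
      (by rw [Real.dist_eq, abs_lt]; constructor <;> linarith)
    rw [Real.dist_eq, abs_lt] at h5
    linarith [h5.2]
end

section
/- Let (X, d) be a separable metric space whose metric is an ultrametric, and let f be any gauge function. Then the pair (X, f) satisfies Assumption(*): there exist a constant α > 1 and a countable family 𝒞 of subsets of X such that for every subset A ⊆ X of finite diameter and every ε > 0 there is C ∈ 𝒞 with A ⊆ C and f(diam(C)) ≤ ε + α·f(diam(A)). -/
open Set

/-- If `(X, d)` is a separable metric space whose metric is an ultrametric,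
then for every gauge function `f`, the pair `(X, f)` satisfies Assumption(*). -/
theorem statement3 {X : Type*} [MetricSpace X] [TopologicalSpace.SeparableSpace X]
    (hultra : ∀ x y z : X, dist x z ≤ max (dist x y) (dist y z))
    (f : ℝ → ℝ) (hf : IsGauge f) :
    AssumptionStar (X := X) f := by
  classical
  obtain ⟨D, hDc, hD⟩ := TopologicalSpace.exists_countable_dense X
  refine ⟨2, by norm_num, insert ∅ ((fun p : X × ℚ => Metric.closedBall p.1 (p.2 : ℝ)) '' (D ×ˢ Set.univ)),
    ((hDc.prod Set.countable_univ).image _).insert _, ?_⟩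
  intro A hA ε hε
  rcases A.eq_empty_or_nonempty with rfl | ⟨a, ha⟩
  · refine ⟨∅, Set.mem_insert _ _, le_rfl, hA, ?_⟩
    have := hf.nonneg (EMetric.diam (∅ : Set X)).toReal ENNReal.toReal_nonneg
    linarith
  · set r := (EMetric.diam A).toReal with hr
    have hr0 : 0 ≤ r := ENNReal.toReal_nonneg
    have h1 := Metric.continuousWithinAt_iff.1 (hf.rightCont r hr0) ε hε
    obtain ⟨δ, hδ, h1⟩ := h1
    obtain ⟨q, hq1, hq2⟩ := exists_rat_btwn (show r < r + δ by linarith)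
    have hq0 : (0 : ℝ) < q := lt_of_le_of_lt hr0 hq1
    obtain ⟨x, hxD, hx⟩ := hD.exists_dist_lt a hq0
    have hball : ∀ y ∈ Metric.closedBall x (q : ℝ), ∀ z ∈ Metric.closedBall x (q : ℝ),
        edist y z ≤ ENNReal.ofReal q := by
      intro y hy z hz
      rw [edist_dist]
      apply ENNReal.ofReal_le_ofReal
      refine (hultra y x z).trans (max_le hy ?_)
      rw [dist_comm]; exact hz
    have hd : EMetric.diam (Metric.closedBall x (q : ℝ)) ≤ ENNReal.ofReal q :=
      Metric.ediam_le hball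
    refine ⟨Metric.closedBall x q, Set.mem_insert_of_mem _ ⟨(x, q), ⟨hxD, Set.mem_univ _⟩, rfl⟩,
      ?_, ne_top_of_le_ne_top ENNReal.ofReal_ne_top hd, ?_⟩
    · intro y hy
      rw [Metric.mem_closedBall]
      refine (hultra y a x).trans (max_le ?_ hx.le)
      have h2 : edist y a ≤ EMetric.diam A := Metric.edist_le_ediam_of_mem hy ha
      have h3 := ENNReal.toReal_mono hA h2
      rw [edist_dist, ENNReal.toReal_ofReal dist_nonneg] at h3
      linarith
    · have h4 : (EMetric.diam (Metric.closedBall x (q : ℝ))).toReal ≤ q :=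
        ENNReal.toReal_le_of_le_ofReal hq0.le hd
      have h5 := hf.mono ENNReal.toReal_nonneg h4
      have h6 := h1 (x := (q : ℝ)) hq1.le (by rw [Real.dist_eq, abs_lt]; constructor <;> linarith)
      rw [Real.dist_eq, abs_lt] at h6
      have h7 := hf.nonneg r hr0
      linarith [h6.2]
end

section
/- For every natural number n > 0 there exists a finite simple graph G (with nonempty vertex set) satisfying all of the following: (1) the vertex set of G cannot be partitioned into n independent sets; (2) for every weight function w : V(G) → [0, ∞) there is an independent set H ⊆ V(G) such that Σ_{g∈H} w(g) ≥ (1/4)·Σ_{g∈V(G)} w(g); (3) there is a family ⟨H(x) : x ∈ V(G)⟩ of independent subsets of G such that x ∈ H(x) for every vertex x, and for every vertex a, the number of vertices x with a ∈ H(x) is at least |V(G)|/4. -/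
open Finset

/-- A set of vertices is independent if it contains no pair of adjacent vertices. -/
def IsIndepSet {V : Type*} (G : SimpleGraph V) (H : Set V) : Prop :=
  ∀ x ∈ H, ∀ y ∈ H, ¬ G.Adj x y

abbrev VV (N : ℕ) := (Fin N × Fin N) × (Fin N → Bool)

def act {N : ℕ} (x : VV N) : Prop := x.1.1 < x.1.2 ∧ x.2 = fun _ => false

def GG (N : ℕ) : SimpleGraph (VV N) where
  Adj x y := act x ∧ act y ∧ (x.1.2 = y.1.1 ∨ y.1.2 = x.1.1)
  symm := ⟨fun _ _ h => ⟨h.2.1, h.1, h.2.2.symm⟩⟩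
  loopless := ⟨fun x h => by
    have h1 := h.1.1
    rcases h.2.2 with h2 | h2 <;> rw [h2] at h1 <;> exact lt_irrefl _ h1⟩

open Classical in
noncomputable def HH {N : ℕ} (x : VV N) : Finset (VV N) :=
  if act x then {x} else univ.filter fun y => ¬ act y ∨ (x.2 y.1.1 = true ∧ x.2 y.1.2 = false)

lemma HH_mem {N : ℕ} (x : VV N) : x ∈ HH x := by
  unfold HH
  split_ifs with h <;> simp [h]

lemma HH_indep {N : ℕ} (x : VV N) : ∀ a ∈ HH x, ∀ b ∈ HH x, ¬ (GG N).Adj a b := by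
  intro a ha b hb hab
  unfold HH at ha hb
  split_ifs at ha hb with h
  · simp only [mem_singleton] at ha hb
    subst ha; subst hb
    exact (GG N).loopless.irrefl _ hab
  · simp only [mem_filter, mem_univ, true_and] at ha hb
    obtain ⟨h1, h2, h3⟩ := hab
    have ha := ha.resolve_left (not_not.2 h1)
    have hb := hb.resolve_left (not_not.2 h2)
    rcases h3 with h3 | h3
    · rw [h3] at ha; simp [hb.1] at ha
    · rw [h3] at hb; simp [ha.1] at hb

lemma count_aux {N : ℕ} (i j : Fin N) (hij : i ≠ j) :
    Fintype.card (VV N) ≤ 4 * (univ.filter fun x : VV N => x.2 i = true ∧ x.2 j = false).card := by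
  classical
  have h : (univ : Finset (VV N)).card ≤
      ((univ.filter fun x : VV N => x.2 i = true ∧ x.2 j = false) ×ˢ
        (univ : Finset (Bool × Bool))).card := by
    apply Finset.card_le_card_of_surjOn
      (fun q => (q.1.1, Function.update (Function.update q.1.2 i q.2.1) j q.2.2))
    intro x _
    refine ⟨((x.1, Function.update (Function.update x.2 i true) j false), (x.2 i, x.2 j)), ?_, ?_⟩
    · simp [Function.update_of_ne hij]
    · refine Prod.ext rfl ?_
      funext k
      by_cases hk : k = j
      · subst hk; simp
      · by_cases hk' : k = i
        · subst hk'; simp [hk]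
        · simp [hk, hk']
  rw [Finset.card_product] at h
  simp only [Finset.card_univ, Fintype.card_prod, Fintype.card_bool] at h ⊢
  omega

lemma HH_count {N : ℕ} (hN : 2 ≤ N) (a : VV N) :
    Fintype.card (VV N) ≤ 4 * Nat.card {x : VV N // a ∈ HH x} := by
  classical
  obtain ⟨i, j, hij, hs⟩ : ∃ i j : Fin N, i ≠ j ∧
      ∀ x : VV N, x.2 i = true ∧ x.2 j = false → a ∈ HH x := by
    have hna : ∀ (i : Fin N) (x : VV N), x.2 i = true → ¬ act x := by
      intro i x h h2
      rw [h2.2] at h; simp at h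
    by_cases ha : act a
    · refine ⟨a.1.1, a.1.2, ha.1.ne, fun x hx => ?_⟩
      simp [HH, hna _ x hx.1, hx]
    · refine ⟨⟨0, by omega⟩, ⟨1, by omega⟩, by simp, fun x hx => ?_⟩
      simp [HH, hna _ x hx.1, ha]
  refine (count_aux i j hij).trans ?_
  rw [Nat.card_eq_fintype_card, Fintype.card_subtype]
  exact Nat.mul_le_mul_left _ (Finset.card_le_card fun x hx => by
    simp only [mem_filter, mem_univ, true_and] at hx ⊢
    exact hs x hx)

lemma GG_chrom (n : ℕ) (p : VV (2 ^ n + 1) → Fin n) :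
    ∃ x y, (GG (2 ^ n + 1)).Adj x y ∧ p x = p y := by
  classical
  by_contra! hcon
  let v (i j : Fin (2 ^ n + 1)) : VV (2 ^ n + 1) := ((i, j), fun _ => false)
  let C (i : Fin (2 ^ n + 1)) : Finset (Fin n) :=
    univ.filter fun c => ∃ j, i < j ∧ p (v i j) = c
  have key : ∀ i j, i < j → C i ≠ C j := by
    intro i j hij h
    have h1 : p (v i j) ∈ C i := by simp only [C, mem_filter, mem_univ, true_and]; exact ⟨j, hij, rfl⟩
    rw [h] at h1
    simp only [C, mem_filter, mem_univ, true_and] at h1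
    obtain ⟨k, hk, hp⟩ := h1
    exact hcon (v i j) (v j k) ⟨⟨hij, rfl⟩, ⟨hk, rfl⟩, Or.inl rfl⟩ hp.symm
  have inj : Function.Injective C := by
    intro i j h
    rcases lt_trichotomy i j with h1 | h1 | h1
    · exact absurd h (key _ _ h1)
    · exact h1
    · exact absurd h.symm (key _ _ h1)
  have := Fintype.card_le_of_injective C inj
  simp at this

/-- For every `n > 0` there is a finite simple graph `G` (with nonempty
vertex set, here `Fin m` with `m > 0`) such that:
(1) the vertex set cannot be partitioned into `n` independent sets;
(2) for every weight function `w : V(G) → [0, ∞)` there is an independent set `H` with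
    `Σ_{g ∈ H} w g ≥ (1/4) Σ_{g ∈ V(G)} w g`;
(3) there is a family `⟨H x : x ∈ V(G)⟩` of independent sets with `x ∈ H x` for all `x`,
    and for every vertex `a`, `|{x : a ∈ H x}| ≥ |V(G)| / 4`. -/
theorem statement6 (n : ℕ) (hn : 0 < n) :
    ∃ (m : ℕ) (_ : 0 < m) (G : SimpleGraph (Fin m)),
      (¬ ∃ p : Fin m → Fin n, ∀ i : Fin n, IsIndepSet G {v | p v = i}) ∧
      (∀ w : Fin m → ℝ, (∀ v, 0 ≤ w v) →
        ∃ H : Finset (Fin m), IsIndepSet G ↑H ∧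
          (1 / 4 : ℝ) * ∑ g : Fin m, w g ≤ ∑ g ∈ H, w g) ∧
      (∃ Hf : Fin m → Finset (Fin m),
        (∀ x, IsIndepSet G ↑(Hf x) ∧ x ∈ Hf x) ∧
        ∀ a : Fin m, (m : ℝ) / 4 ≤ ((Finset.univ.filter fun x => a ∈ Hf x).card : ℝ)) := by

  classical
  let N := 2 ^ n + 1
  have hN : 2 ≤ N := by have := Nat.one_le_two_pow (n := n); omega
  let e := Fintype.equivFin (VV N)
  have : Nonempty (VV N) := ⟨((⟨0, by omega⟩, ⟨0, by omega⟩), fun _ => false)⟩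
  have hm : 0 < Fintype.card (VV N) := Fintype.card_pos
  let Hf : Fin (Fintype.card (VV N)) → Finset (Fin (Fintype.card (VV N))) :=
    fun x => univ.filter fun a => e.symm a ∈ HH (e.symm x)
  have hind : ∀ x, IsIndepSet ((GG N).comap e.symm) ↑(Hf x) := by
    intro x a ha b hb hab
    simp only [Hf, coe_filter, mem_univ, true_and, Set.mem_ofPred_eq] at ha hb
    exact HH_indep _ _ ha _ hb hab
  have hcount : ∀ a, ((Fintype.card (VV N) : ℕ) : ℝ) / 4 ≤
      ((Finset.univ.filter fun x => a ∈ Hf x).card : ℝ) := by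
    intro a
    have h := HH_count hN (e.symm a)
    have h2 : Nat.card {x : VV N // e.symm a ∈ HH x} =
        (Finset.univ.filter fun x => a ∈ Hf x).card := by
      rw [← Fintype.card_subtype, ← Nat.card_eq_fintype_card (α := {x // a ∈ Hf x})]
      exact Nat.card_congr (e.subtypeEquiv fun x => by simp [Hf])
    rw [h2] at h
    have h3 : ((Fintype.card (VV N) : ℕ) : ℝ) ≤
      4 * ((Finset.univ.filter fun x => a ∈ Hf x).card : ℝ) := by exact_mod_cast h
    linarith
  refine ⟨Fintype.card (VV N), hm, (GG N).comap e.symm, ?_, ?_, Hf, ?_, ?_⟩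
  · rintro ⟨p, hp⟩
    obtain ⟨x, y, hxy, h⟩ := GG_chrom n (fun x => p (e x))
    exact hp (p (e x)) (e x) rfl (e y) h.symm (by simpa using hxy)
  · intro w hw
    by_contra! hcon
    have h1 : ∑ x, ∑ g ∈ Hf x, w g <
        ∑ x : Fin (Fintype.card (VV N)), (1 / 4 : ℝ) * ∑ g, w g := by
      apply Finset.sum_lt_sum_of_nonempty
      · exact ⟨⟨0, hm⟩, mem_univ _⟩
      · exact fun x _ => hcon (Hf x) (hind x)
    have h2 : ∑ x, ∑ g ∈ Hf x, w g =
        ∑ g, ((Finset.univ.filter fun x => g ∈ Hf x).card : ℝ) * w g := by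
      rw [Finset.sum_comm' (t' := univ) (s' := fun g => univ.filter fun x => g ∈ Hf x)]
      · simp
      · simp
    have h3 : ∑ g, ((Fintype.card (VV N) : ℕ) : ℝ) / 4 * w g ≤ ∑ x, ∑ g ∈ Hf x, w g := by
      rw [h2]
      exact Finset.sum_le_sum fun g _ => mul_le_mul_of_nonneg_right (hcount g) (hw g)
    rw [← Finset.mul_sum] at h3
    rw [Finset.sum_const, Finset.card_univ, Fintype.card_fin, nsmul_eq_mul] at h1
    linarith
  · intro x
    exact ⟨hind x, by simp [Hf, HH_mem]⟩
  · intro a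
    convert hcount a
end

section
/- With the Davies–Rogers construction data (graphs G_n satisfying (i) and (ii), space Ω, metric ρ, gauge h as in the context), the h-Hausdorff measure of the whole space is infinite: H^h(Ω) = ∞. -/
open Set ENNReal Finset

/-- The `δ`-approximation of the `f`-Hausdorff measure. -/
noncomputable def hausdorffApprox {X : Type*} [MetricSpace X] (f : ℝ → ℝ) (δ : ℝ)
    (A : Set X) : ℝ≥0∞ :=
  ⨅ (C : ℕ → Set X) (_ : A ⊆ ⋃ n, C n) (_ : ∀ n, EMetric.diam (C n) ≤ ENNReal.ofReal δ),
    ∑' n, ENNReal.ofReal (f (EMetric.diam (C n)).toReal)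

/-- The `f`-Hausdorff measure: `H^f(A) = sup_{δ > 0} H^f_δ(A)`. -/
noncomputable def hausdorffGauge {X : Type*} [MetricSpace X] (f : ℝ → ℝ) (A : Set X) : ℝ≥0∞ :=
  ⨆ (δ : ℝ) (_ : 0 < δ), hausdorffApprox f δ A

lemma dr_color {V : Type} [Fintype V] (G : SimpleGraph V) (m : ℕ)
    (hpart : ¬ ∃ p : V → Fin m, ∀ i : Fin m, IsIndepSet G {v | p v = i})
    {κ : Type} [Fintype κ] (p : V → κ) (hp : ∀ x y, p x = p y → ¬ G.Adj x y) :
    m < Fintype.card κ := by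
  by_contra hc
  push Not at hc
  obtain ⟨e⟩ : Nonempty (κ ↪ Fin m) := by
    apply Function.Embedding.nonempty_of_card_le
    simpa using hc
  apply hpart
  refine ⟨fun v => e (p v), fun i x hx y hy => hp x y (e.injective ?_)⟩
  simp only [Set.mem_setOf_eq] at hx hy
  rw [hx, hy]

lemma dr_greedy {V : Type} [Fintype V] (G : SimpleGraph V)
    (hweight : ∀ w : V → ℝ, (∀ v, 0 ≤ w v) →
      ∃ H : Finset V, IsIndepSet G ↑H ∧
        (1 / 4 : ℝ) * ∑ g : V, w g ≤ ∑ g ∈ H, w g) (j : ℕ) :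
    ∃ (S : Finset V) (p : V → ℕ), (S.card : ℝ) ≤ (3/4)^j * Fintype.card V ∧
      (∀ x, x ∉ S → p x < j) ∧
      ∀ x y, x ∉ S → y ∉ S → p x = p y → ¬ G.Adj x y := by
  classical
  induction j with
  | zero => exact ⟨Finset.univ, fun _ => 0, by simp, by simp, by simp⟩
  | succ j ih =>
    obtain ⟨S, p, h1, h2, h3⟩ := ih
    obtain ⟨H, hH, hw⟩ := hweight (fun v => if v ∈ S then 1 else 0)
      (fun v => by split_ifs <;> norm_num)
    refine ⟨S \ H, fun v => if v ∈ S then j else p v, ?_, ?_, ?_⟩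
    · simp only [Finset.sum_ite_mem, Finset.sum_const, nsmul_eq_mul, mul_one,
        Finset.univ_inter] at hw
      have hc : ((S \ H).card : ℝ) + ((H ∩ S).card : ℝ) = S.card := by
        have := Finset.card_sdiff_add_card_inter S H
        rw [Finset.inter_comm H S]
        exact_mod_cast this
      rw [pow_succ]
      nlinarith
    · intro x hx
      simp only [Finset.mem_sdiff, not_and, not_not] at hx
      dsimp only
      split_ifs with hs
      · omega
      · have := h2 x hs
        omega
    · intro x y hx hy hxy
      simp only [Finset.mem_sdiff, not_and, not_not] at hx hy
      dsimp only at hxy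
      split_ifs at hxy with a b b
      · exact hH x (hx a) y (hy b)
      · have := h2 y b
        omega
      · have := h2 x a
        omega
      · exact h3 x y a b hxy

lemma dr_exp {V : Type} [Fintype V] (G : SimpleGraph V) (m : ℕ)
    (hpart : ¬ ∃ p : V → Fin m, ∀ i : Fin m, IsIndepSet G {v | p v = i})
    (hweight : ∀ w : V → ℝ, (∀ v, 0 ≤ w v) →
      ∃ H : Finset V, IsIndepSet G ↑H ∧
        (1 / 4 : ℝ) * ∑ g : V, w g ≤ ∑ g ∈ H, w g) :
    (4/3 : ℝ)^m ≤ Fintype.card V := by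
  obtain ⟨S, p, h1, h2, h3⟩ := dr_greedy G hweight m
  have hS : S.Nonempty := by
    by_contra hS
    rw [Finset.not_nonempty_iff_eq_empty] at hS
    subst hS
    apply hpart
    refine ⟨fun v => ⟨p v, h2 v (by simp)⟩, fun i x hx y hy => h3 x y (by simp) (by simp) ?_⟩
    simp only [Set.mem_setOf_eq] at hx hy
    simpa using hx.trans hy.symm
  have h4 : (1:ℝ) ≤ S.card := by exact_mod_cast hS.card_pos
  have h5 : (4/3 : ℝ)^m * (3/4)^m = 1 := by
    rw [← mul_pow]; norm_num
  have h6 : (0:ℝ) < (4/3)^m := by positivity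
  calc (4/3 : ℝ)^m = (4/3)^m * 1 := by ring
    _ ≤ (4/3)^m * ((3/4)^m * Fintype.card V) := by
        apply mul_le_mul_of_nonneg_left (h4.trans h1) h6.le
    _ = ((4/3)^m * (3/4)^m) * Fintype.card V := by ring
    _ = _ := by rw [h5, one_mul]

lemma dr_local (V : ℕ → Type) [∀ n, Fintype (V n)]
    (G : ∀ n, SimpleGraph (V n)) (M : ℕ → ℕ) (hMpos : ∀ n, 0 < M n)
    (hpart : ∀ n, ¬ ∃ p : V n → Fin (M n), ∀ i : Fin (M n), IsIndepSet (G n) {v | p v = i})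
    (L : ℕ → ℕ) (b : ℕ → ∀ n, V n) (I : ∀ i, Set (V (L i)))
    (hI : ∀ i, IsIndepSet (G (L i)) (I i)) (d : ℕ) :
    ∀ (k : ℕ) (F : Finset ℕ) (x : ∀ n, V n), (∀ i ∈ F, k ≤ L i ∧ L i < k + d) →
      (∀ y : ∀ n, V n, (∀ j < k, y j = x j) →
        ∃ i ∈ F, (∀ j < L i, y j = b i j) ∧ y (L i) ∈ I i) →
      1 / ∏ j ∈ Finset.range k, (M j : ℝ) ≤
        ∑ i ∈ F, 1 / ∏ j ∈ Finset.range (L i + 1), (M j : ℝ) := by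
  classical
  induction d with
  | zero =>
    intro k F x hF hc
    obtain ⟨i, hi, -⟩ := hc x (fun _ _ => rfl)
    have := hF i hi
    omega
  | succ d ih =>
    intro k F x hF hc
    set c : ℕ → ℝ := fun i => 1 / ∏ j ∈ Finset.range (L i + 1), (M j : ℝ) with hcdef
    have hcpos : ∀ i, 0 ≤ c i := fun i => by positivity
    set q : ℝ := 1 / ∏ j ∈ Finset.range (k + 1), (M j : ℝ) with hq
    have hq0 : 0 ≤ q := by positivity
    set F0 := F.filter (fun i => L i = k) with hF0
    let cov : V k → ℕ → Prop := fun v i => ∃ e : L i = k, e ▸ v ∈ I i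
    set U : Finset (V k) := Finset.univ.filter (fun v => ∀ i ∈ F0, ¬ cov v i) with hU
    let Fv : V k → Finset ℕ := fun v => F.filter (fun i => k < L i ∧ b i k = v)
    have hv : ∀ v ∈ U, q ≤ ∑ i ∈ Fv v, c i := by
      intro v hvU
      apply ih (k+1) (Fv v) (Function.update x k v)
      · intro i hi
        simp only [Fv, Finset.mem_filter] at hi
        have := hF i hi.1
        omega
      · intro y hy
        have hyk : y k = v := by simpa using hy k (by omega)
        obtain ⟨i, hi, hb, hyI⟩ := hc y (fun j hj => by
          rw [hy j (by omega), Function.update_of_ne (by omega)])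
        refine ⟨i, ?_, hb, hyI⟩
        simp only [Fv, Finset.mem_filter]
        have hle := (hF i hi).1
        rcases hle.eq_or_lt with he | hlt
        · exfalso
          simp only [hU, Finset.mem_filter, Finset.mem_univ, true_and] at hvU
          apply hvU i (by simp [hF0, hi, he])
          refine ⟨he.symm, ?_⟩
          subst hyk
          have : ∀ (n : ℕ) (e : n = k) (J : Set (V n)), y n ∈ J → (e ▸ (y k) : V n) ∈ J := by
            intro n e J hJ
            subst e
            exact hJ
          exact this _ he.symm _ hyI
        · exact ⟨hi, hlt, by rw [← hb k hlt, hyk]⟩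
    have hcard : M k < F0.card + U.card := by
      have hex : ∀ v : V k, ∃ s : {i // i ∈ F0} ⊕ {v // v ∈ U},
          Sum.elim (fun i => cov v i.1) (fun u => u.1 = v) s := by
        intro v
        by_cases hvU : v ∈ U
        · exact ⟨Sum.inr ⟨v, hvU⟩, rfl⟩
        · simp only [hU, Finset.mem_filter, Finset.mem_univ, true_and] at hvU
          push Not at hvU
          obtain ⟨i, hi, hcv⟩ := hvU
          exact ⟨Sum.inl ⟨i, hi⟩, hcv⟩
      choose p hp using hex
      have := dr_color (G k) (M k) (hpart k) p (by
        intro v w hvw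
        have h1 := hp v
        have h2 := hp w
        rw [← hvw] at h2
        generalize p v = s at h1 h2
        rcases s with i | u
        · obtain ⟨e, h1⟩ := h1
          obtain ⟨_, h2⟩ := h2
          have : ∀ (n : ℕ) (e : n = k) (J : Set (V n)), IsIndepSet (G n) J →
              (e ▸ v : V n) ∈ J → (e ▸ w : V n) ∈ J → ¬ (G k).Adj v w := by
            intro n e J hJ a b
            subst e
            exact hJ _ a _ b
          exact this _ e _ (hI i) h1 h2
        · change u.1 = v at h1
          change u.1 = w at h2
          rw [← h1, ← h2]
          exact (G k).loopless.irrefl _)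
      simpa using this
    have hdisj : ((U : Set (V k))).PairwiseDisjoint Fv := by
      intro v _ w _ hvw
      rw [Function.onFun, Finset.disjoint_left]
      intro i h1 h2
      simp only [Fv, Finset.mem_filter] at h1 h2
      exact hvw (h1.2.2.symm.trans h2.2.2)
    have hdisj2 : Disjoint F0 (U.biUnion Fv) := by
      rw [Finset.disjoint_left]
      intro i h1 h2
      simp only [hF0, Fv, Finset.mem_filter, Finset.mem_biUnion] at h1 h2
      obtain ⟨_, _, _, h, _⟩ := h2
      omega
    have hsub : F0 ∪ U.biUnion Fv ⊆ F := by
      apply Finset.union_subset (Finset.filter_subset _ _)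
      rw [Finset.biUnion_subset]
      exact fun _ _ => Finset.filter_subset _ _
    have hMk : (0:ℝ) < M k := by exact_mod_cast hMpos k
    have hqM : 1 / ∏ j ∈ Finset.range k, (M j : ℝ) = M k * q := by
      rw [hq, Finset.prod_range_succ]
      have : (0:ℝ) < ∏ j ∈ Finset.range k, (M j : ℝ) :=
        Finset.prod_pos (fun j _ => by exact_mod_cast hMpos j)
      field_simp
    have hcardR : (M k : ℝ) ≤ F0.card + U.card := by exact_mod_cast hcard.le
    have hs0 : ∑ i ∈ F0, c i = F0.card * q := by
      rw [Finset.sum_congr rfl (g := fun _ => q)]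
      · simp
      · intro i hi
        simp only [hF0, Finset.mem_filter] at hi
        simp only [hcdef, hq, hi.2]
    rw [hqM]
    calc (M k : ℝ) * q ≤ (F0.card + U.card) * q := mul_le_mul_of_nonneg_right hcardR hq0
      _ = ∑ i ∈ F0, c i + ∑ v ∈ U, q := by rw [hs0]; simp; ring
      _ ≤ ∑ i ∈ F0, c i + ∑ v ∈ U, ∑ i ∈ Fv v, c i := by
          gcongr with v hvU
          exact hv v hvU
      _ = ∑ i ∈ F0 ∪ U.biUnion Fv, c i := by
          rw [Finset.sum_union hdisj2, Finset.sum_biUnion hdisj]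
      _ ≤ ∑ i ∈ F, c i := Finset.sum_le_sum_of_subset_of_nonneg hsub (fun i _ _ => hcpos i)

lemma dr_compact (V : ℕ → Type) [∀ n, Fintype (V n)]
    (L : ℕ → ℕ) (b : ℕ → ∀ n, V n) (I : ∀ i, Set (V (L i)))
    (hc : ∀ y : ∀ n, V n, ∃ i, (∀ j < L i, y j = b i j) ∧ y (L i) ∈ I i) :
    ∃ F : Finset ℕ, ∀ y : ∀ n, V n, ∃ i ∈ F, (∀ j < L i, y j = b i j) ∧ y (L i) ∈ I i := by
  letI : ∀ n, TopologicalSpace (V n) := fun _ => ⊥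
  haveI : ∀ n, DiscreteTopology (V n) := fun _ => ⟨rfl⟩
  obtain ⟨F, hF⟩ := (isCompact_univ (X := ∀ n, V n)).elim_finite_subcover
    (fun i => {y : ∀ n, V n | (∀ j < L i, y j = b i j) ∧ y (L i) ∈ I i})
    (by
      intro i
      have : {y : ∀ n, V n | (∀ j < L i, y j = b i j) ∧ y (L i) ∈ I i} =
          (⋂ j ∈ Finset.range (L i), (fun y : ∀ n, V n => y j) ⁻¹' {b i j}) ∩
            (fun y : ∀ n, V n => y (L i)) ⁻¹' (I i) := by
        ext y; simp
      rw [this]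
      apply IsOpen.inter
      · apply isOpen_biInter_finset
        intro j _
        exact (isOpen_discrete _).preimage (continuous_apply j)
      · exact (isOpen_discrete _).preimage (continuous_apply (L i)))
    (by
      intro y _
      simpa using hc y)
  refine ⟨F, fun y => ?_⟩
  obtain ⟨i, hi, hy⟩ := Set.mem_iUnion₂.1 (hF (Set.mem_univ y))
  exact ⟨i, hi, hy⟩

lemma dr_core (V : ℕ → Type) [∀ n, Fintype (V n)] [∀ n, Nonempty (V n)]
    (G : ∀ n, SimpleGraph (V n)) (M : ℕ → ℕ) (hMpos : ∀ n, 0 < M n)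
    (hM0 : M 0 = 1) (hMsucc : ∀ n, M (n + 1) = 2 * Fintype.card (V n))
    (hpart : ∀ n, ¬ ∃ p : V n → Fin (M n), ∀ i : Fin (M n), IsIndepSet (G n) {v | p v = i})
    (L : ℕ → ℕ) (b : ℕ → ∀ n, V n) (I : ∀ i, Set (V (L i)))
    (hI : ∀ i, IsIndepSet (G (L i)) (I i)) (m : ℕ) (hL : ∀ i, m + 1 ≤ L i)
    (hc : ∀ y : ∀ n, V n, ∃ i, (∀ j < L i, y j = b i j) ∧ y (L i) ∈ I i) :
    ENNReal.ofReal (Fintype.card (V m) / 2^m) ≤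
      ∑' i, ENNReal.ofReal (1 / ∏ j ∈ Finset.range (L i + 1), (M j : ℝ)) := by
  classical
  obtain ⟨F, hF⟩ := dr_compact V L b I hc
  set c : ℕ → ℝ := fun i => 1 / ∏ j ∈ Finset.range (L i + 1), (M j : ℝ) with hcdef
  have hcpos : ∀ i, 0 ≤ c i := fun i => by positivity
  refine le_trans ?_ (ENNReal.sum_le_tsum F)
  rw [← ENNReal.ofReal_sum_of_nonneg (fun i _ => hcpos i)]
  apply ENNReal.ofReal_le_ofReal
  let T := ∀ j : Fin (m+1), V j
  let r : (∀ n, V n) → T := fun y j => y j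
  have hext : ∀ t : T, ∃ x : ∀ n, V n, r x = t := by
    intro t
    refine ⟨fun n => if hn : n < m + 1 then t ⟨n, hn⟩ else Classical.arbitrary _, ?_⟩
    funext j
    simp only [r]
    rw [dif_pos j.2]
  have ht : ∀ t : T, 1 / ∏ j ∈ Finset.range (m+1), (M j : ℝ) ≤
      ∑ i ∈ F with r (b i) = t, c i := by
    intro t
    obtain ⟨x, rfl⟩ := hext t
    apply dr_local V G M hMpos hpart L b I hI (∑ i ∈ F, L i + 1) (m+1) _ x
    · intro i hi
      have hi' := (Finset.mem_filter.1 hi).1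
      have := Finset.single_le_sum (f := L) (fun i _ => Nat.zero_le _) hi'
      have := hL i
      omega
    · intro y hy
      obtain ⟨i, hi, hb, hyI⟩ := hF y
      refine ⟨i, Finset.mem_filter.2 ⟨hi, ?_⟩, hb, hyI⟩
      funext j
      have := hL i
      have := j.2
      simp only [r]
      rw [← hb j (by omega), hy j (by omega)]
  have hprod : ∀ m : ℕ, ∏ j ∈ Finset.range (m+1), (M j : ℝ) =
      2^m * ∏ j ∈ Finset.range m, (Fintype.card (V j) : ℝ) := by
    intro m
    induction m with
    | zero => simp [hM0]
    | succ m ih =>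
      rw [Finset.prod_range_succ, ih, hMsucc, Finset.prod_range_succ]
      push_cast
      ring
  have hcardT : (Fintype.card T : ℝ) = ∏ j ∈ Finset.range (m+1), (Fintype.card (V j) : ℝ) := by
    simp only [T, Fintype.card_pi]
    push_cast
    rw [Fin.prod_univ_eq_prod_range (fun j => (Fintype.card (V j) : ℝ)) (m+1)]
  calc (Fintype.card (V m) : ℝ) / 2^m
      = ∑ t : T, 1 / ∏ j ∈ Finset.range (m+1), (M j : ℝ) := by
        rw [Finset.sum_const, Finset.card_univ, nsmul_eq_mul, hcardT, hprod,
          Finset.prod_range_succ]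
        have : (0:ℝ) < ∏ j ∈ Finset.range m, (Fintype.card (V j) : ℝ) :=
          Finset.prod_pos (fun j _ => by exact_mod_cast Fintype.card_pos)
        field_simp
    _ ≤ ∑ t : T, ∑ i ∈ F with r (b i) = t, c i := Finset.sum_le_sum (fun t _ => ht t)
    _ = ∑ i ∈ F, c i := Finset.sum_fiberwise F (fun i => r (b i)) c

/-- With the Davies–Rogers construction data (graphs `G n` on vertex sets
`V n` satisfying (i) and (ii), the product space `Ω = Π n, V n` with metric `ρ`, and the
gauge `h`), the `h`-Hausdorff measure of the whole space `Ω` is infinite. -/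
theorem statement9
    -- the vertex sets and graphs
    (V : ℕ → Type) [∀ n, Fintype (V n)] [∀ n, Nonempty (V n)]
    (G : ∀ n, SimpleGraph (V n))
    -- the sequence M with M 0 = 1 and M (n+1) = 2 · N n, where N n = |V (G n)|
    (M : ℕ → ℕ) (hM0 : M 0 = 1) (hMsucc : ∀ n, M (n + 1) = 2 * Fintype.card (V n))
    -- (i): the vertex set of `G n` cannot be partitioned into `M n` independent sets
    (hpart : ∀ n, ¬ ∃ p : V n → Fin (M n), ∀ i : Fin (M n), IsIndepSet (G n) {v | p v = i})
    -- (ii): the weighted independent-set property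
    (hweight : ∀ n, ∀ w : V n → ℝ, (∀ v, 0 ≤ w v) →
      ∃ H : Finset (V n), IsIndepSet (G n) ↑H ∧
        (1 / 4 : ℝ) * ∑ g : V n, w g ≤ ∑ g ∈ H, w g)
    -- the metric ρ on Ω
    [MetricSpace (∀ n, V n)]
    (hdist_adj : ∀ x y : ∀ n, V n, ∀ n : ℕ, (∀ k, k < n → x k = y k) → x n ≠ y n →
      (G n).Adj (x n) (y n) → dist x y = (2 : ℝ) ^ (1 - (n : ℤ)))
    (hdist_nadj : ∀ x y : ∀ n, V n, ∀ n : ℕ, (∀ k, k < n → x k = y k) → x n ≠ y n →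
      ¬ (G n).Adj (x n) (y n) → dist x y = (2 : ℝ) ^ (-(n : ℤ)))
    -- the gauge function h
    (h : ℝ → ℝ) (hh0 : h 0 = 0)
    (hhval : ∀ n : ℕ,
      h ((2 : ℝ) ^ (-(n : ℤ))) = 1 / ∏ k ∈ Finset.range (n + 1), (M k : ℝ))
    (hlin : ∀ n : ℕ, ∀ t : ℝ, (2 : ℝ) ^ (-(n : ℤ) - 1) ≤ t → t ≤ (2 : ℝ) ^ (-(n : ℤ)) →
      h t = h ((2 : ℝ) ^ (-(n : ℤ) - 1)) +
        (t - (2 : ℝ) ^ (-(n : ℤ) - 1)) *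
          (h ((2 : ℝ) ^ (-(n : ℤ))) - h ((2 : ℝ) ^ (-(n : ℤ) - 1))) /
            ((2 : ℝ) ^ (-(n : ℤ)) - (2 : ℝ) ^ (-(n : ℤ) - 1)))
    (hone : ∀ t : ℝ, 1 ≤ t → h t = 1) :
    hausdorffGauge h (Set.univ : Set (∀ n, V n)) = ⊤ := by
  classical
  have hMpos : ∀ n, 0 < M n := by
    intro n
    cases n with
    | zero => omega
    | succ n => rw [hMsucc]; have : 0 < Fintype.card (V n) := Fintype.card_pos; omega
  have hMN : ∀ n, M n < Fintype.card (V n) := fun n =>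
    dr_color (G n) (M n) (hpart n) id (fun x y hxy => by
      simp only [id] at hxy
      rw [hxy]
      exact (G n).loopless.irrefl _)
  have hM2 : ∀ n, 2^n ≤ M n := by
    intro n
    induction n with
    | zero => simp [hM0]
    | succ n ih => rw [hMsucc, pow_succ]; have := hMN n; omega
  have hNgrow : ∀ n, (2:ℝ)^n / 18 ≤ Fintype.card (V (n+1)) / 2^(n+1) := by
    intro n
    have h1 := dr_exp (G (n+1)) (M (n+1)) (hpart _) (hweight _)
    have h2 : (4/3:ℝ)^(2^(n+1)) ≤ (4/3)^(M (n+1)) :=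
      pow_le_pow_right₀ (by norm_num) (hM2 _)
    have h3 := one_add_mul_le_pow (a := (1/3:ℝ)) (by norm_num) (2^n)
    have h4 : (4/3:ℝ)^(2^(n+1)) = ((1 + 1/3)^(2^n))^2 := by
      rw [← pow_mul, ← pow_succ]; norm_num
    push_cast at h3
    have h5 : (0:ℝ) < 2^n := by positivity
    rw [le_div_iff₀ (by positivity)]
    calc (2:ℝ)^n / 18 * 2^(n+1) = (2^n * (1/3))^2 := by rw [pow_succ]; ring
      _ ≤ ((1 + 1/3)^(2^n))^2 := by
          apply pow_le_pow_left₀ (by positivity)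
          linarith
      _ ≤ _ := by rw [← h4]; linarith
  have hP : ∀ n, (0:ℝ) < ∏ k ∈ Finset.range n, (M k : ℝ) := fun n =>
    Finset.prod_pos (fun j _ => by exact_mod_cast hMpos j)
  have hP2 : ∀ n, (2:ℝ)^n ≤ ∏ k ∈ Finset.range (n+1), (M k : ℝ) := by
    intro n
    induction n with
    | zero => simp [hM0]
    | succ n ih =>
      rw [Finset.prod_range_succ, pow_succ]
      have : (2:ℝ) ≤ M (n+1) := by
        rw [hMsucc]
        have : 0 < Fintype.card (V n) := Fintype.card_pos
        exact_mod_cast (by omega : 2 ≤ 2 * Fintype.card (V n))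
      exact mul_le_mul ih this (by norm_num) (hP _).le
  -- geometry
  have hgeo : ∀ (x y : ∀ n, V n) (n : ℕ), dist x y < 2 * (2:ℝ)^(-(n:ℤ)) →
      (∀ j < n, x j = y j) ∧ ¬ (G n).Adj (x n) (y n) := by
    intro x y n hd
    by_cases hxy : x = y
    · subst hxy
      exact ⟨fun _ _ => rfl, (G n).loopless.irrefl _⟩
    have hex : ∃ k, x k ≠ y k := by
      by_contra hne
      push Not at hne
      exact hxy (funext hne)
    obtain ⟨k, hk, hmin⟩ : ∃ k, x k ≠ y k ∧ ∀ j < k, x j = y j :=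
      ⟨Nat.find hex, Nat.find_spec hex, fun j hj => by
        have := Nat.find_min hex hj
        push Not at this
        exact this⟩
    have e1 : (2:ℝ) * 2^(-(n:ℤ)) = 2^(1-(n:ℤ)) := by
      rw [sub_eq_add_neg, zpow_add₀ (by norm_num), zpow_one]
    rw [e1] at hd
    by_cases ha : (G k).Adj (x k) (y k)
    · rw [hdist_adj x y k hmin hk ha, zpow_lt_zpow_iff_right₀ (by norm_num)] at hd
      refine ⟨fun j hj => hmin j (by omega), ?_⟩
      rw [hmin n (by omega)]
      exact (G n).loopless.irrefl _
    · rw [hdist_nadj x y k hmin hk ha, zpow_lt_zpow_iff_right₀ (by norm_num)] at hd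
      refine ⟨fun j hj => hmin j (by omega), ?_⟩
      rcases (show n ≤ k by omega).eq_or_lt with he | hlt
      · subst he; exact ha
      · rw [hmin n hlt]
        exact (G n).loopless.irrefl _
  -- key
  have hkey : ∀ m : ℕ, ENNReal.ofReal (Fintype.card (V m) / 2^m) ≤
      hausdorffGauge h (Set.univ : Set (∀ n, V n)) + 1 := by
    intro m
    have hδ : (0:ℝ) < 2^(-((m+1:ℕ):ℤ)) := by positivity
    refine le_trans ?_ (add_le_add_left
      (le_iSup₂_of_le (f := fun (δ : ℝ) (_ : 0 < δ) =>
        hausdorffApprox h δ (Set.univ : Set (∀ n, V n))) _ hδ le_rfl) 1)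
    unfold hausdorffApprox
    rw [← tsub_le_iff_right]
    refine le_iInf fun C => le_iInf fun hC => le_iInf fun hdiam => ?_
    rw [tsub_le_iff_right]
    obtain ⟨ε, hε, hεs⟩ := ENNReal.exists_pos_sum_of_countable' (one_ne_zero) ℕ
    have hch : ∀ i, ∃ (l : ℕ) (b : ∀ n, V n) (J : Set (V l)), m + 1 ≤ l ∧ IsIndepSet (G l) J ∧
        (∀ y ∈ C i, (∀ j < l, y j = b j) ∧ y l ∈ J) ∧
        ENNReal.ofReal (1 / ∏ j ∈ Finset.range (l + 1), (M j : ℝ)) ≤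
          ENNReal.ofReal (h (EMetric.diam (C i)).toReal) + ε i := by
      intro i
      by_cases hsub : (C i).Subsingleton
      · obtain ⟨b, hb⟩ : ∃ b : ∀ n, V n, ∀ y ∈ C i, y = b := by
          rcases (C i).eq_empty_or_nonempty with he | ⟨b, hb⟩
          · exact ⟨fun n => Classical.arbitrary _, by simp [he]⟩
          · exact ⟨b, fun y hy => hsub hy hb⟩
        obtain ⟨l, hl1, hl2⟩ : ∃ l, m + 1 ≤ l ∧
            ENNReal.ofReal (1 / ∏ j ∈ Finset.range (l + 1), (M j : ℝ)) ≤ ε i := by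
          have ht : Filter.Tendsto (fun l : ℕ => ENNReal.ofReal ((1/2:ℝ)^l)) Filter.atTop
              (nhds 0) := by
            have := ENNReal.tendsto_ofReal (tendsto_pow_atTop_nhds_zero_of_lt_one
              (r := (1/2:ℝ)) (by norm_num) (by norm_num))
            simpa using this
          obtain ⟨l, h1, h2⟩ := ((ht.eventually (gt_mem_nhds (hε i))).and
            (Filter.eventually_ge_atTop (m+1))).exists
          refine ⟨l, h2, le_trans (ENNReal.ofReal_le_ofReal ?_) h1.le⟩
          rw [div_pow, one_pow]
          exact one_div_le_one_div_of_le (by positivity) (hP2 l)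
        refine ⟨l, b, {b l}, hl1, ?_, ?_, hl2.trans le_add_self⟩
        · intro x hx y hy
          rw [Set.mem_singleton_iff] at hx hy
          rw [hx, hy]
          exact (G l).loopless.irrefl _
        · intro y hy
          rw [hb y hy]
          simp
      · have hfin : EMetric.diam (C i) ≠ ⊤ := ne_top_of_le_ne_top ENNReal.ofReal_ne_top (hdiam i)
        set D := (EMetric.diam (C i)).toReal with hD
        have hdist : ∀ x ∈ C i, ∀ y ∈ C i, dist x y ≤ D := by
          intro x hx y hy
          rw [dist_edist]
          exact ENNReal.toReal_mono hfin (EMetric.edist_le_diam_of_mem hx hy)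
        obtain ⟨x, hx, y, hy, hxy⟩ := Set.not_subsingleton_iff.1 hsub
        have hDpos : 0 < D := lt_of_lt_of_le (dist_pos.2 hxy) (hdist x hx y hy)
        have hDle : D ≤ 2^(-((m+1:ℕ):ℤ)) := ENNReal.toReal_le_of_le_ofReal hδ.le (hdiam i)
        obtain ⟨z, hz1, hz2⟩ := exists_mem_Ico_zpow hDpos (one_lt_two)
        have hzm : z ≤ -((m+1:ℕ):ℤ) :=
          (zpow_le_zpow_iff_right₀ (by norm_num : (1:ℝ) < 2)).1 (hz1.trans hDle)
        obtain ⟨n, rfl⟩ : ∃ n : ℕ, z = -((n+1:ℕ):ℤ) := ⟨(-z-1).toNat, by omega⟩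
        have hgeo' : ∀ u ∈ C i, ∀ v ∈ C i, (∀ j < n+1, u j = v j) ∧
            ¬ (G (n+1)).Adj (u (n+1)) (v (n+1)) := by
          intro u hu v hv
          apply hgeo
          refine lt_of_le_of_lt (hdist u hu v hv) (lt_of_lt_of_eq hz2 ?_)
          rw [zpow_add₀ (by norm_num), zpow_one, mul_comm]
        refine ⟨n+1, x, (fun u : ∀ n, V n => u (n+1)) '' C i, by omega, ?_, ?_, ?_⟩
        · rintro _ ⟨u, hu, rfl⟩ _ ⟨v, hv, rfl⟩
          exact (hgeo' u hu v hv).2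
        · intro u hu
          exact ⟨(hgeo' u hu x hx).1, u, hu, rfl⟩
        · refine le_trans (ENNReal.ofReal_le_ofReal ?_) le_self_add
          have e1 : (-(n:ℤ) - 1) = -((n+1:ℕ):ℤ) := by push_cast; ring
          have e2 : -((n+1:ℕ):ℤ) + 1 = -(n:ℤ) := by push_cast; ring
          rw [e2] at hz2
          have := hlin n D (by rw [e1]; exact hz1) hz2.le
          rw [this, e1, ← hhval (n+1)]
          have hmono : h ((2:ℝ)^(-((n+1:ℕ):ℤ))) ≤ h ((2:ℝ)^(-(n:ℤ))) := by
            rw [hhval, hhval]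
            apply one_div_le_one_div_of_le (hP _)
            rw [Finset.prod_range_succ _ (n+1)]
            have : (1:ℝ) ≤ M (n+1) := by exact_mod_cast hMpos (n+1)
            exact le_mul_of_one_le_right (hP _).le this
          have : 0 ≤ (D - (2:ℝ)^(-((n+1:ℕ):ℤ))) *
              (h ((2:ℝ)^(-(n:ℤ))) - h ((2:ℝ)^(-((n+1:ℕ):ℤ)))) /
              ((2:ℝ)^(-(n:ℤ)) - (2:ℝ)^(-((n+1:ℕ):ℤ))) := by
            apply div_nonneg
            · exact mul_nonneg (by linarith) (by linarith)
            · linarith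
          linarith
    choose L b I hL hI hCI hcost using hch
    refine (dr_core V G M hMpos hM0 hMsucc hpart L b I hI m hL ?_).trans ?_
    · intro y
      obtain ⟨i, hi⟩ := Set.mem_iUnion.1 (hC (Set.mem_univ y))
      exact ⟨i, hCI i y hi⟩
    · refine (ENNReal.tsum_le_tsum hcost).trans ?_
      rw [ENNReal.tsum_add]
      gcongr
  by_contra hne
  have hne' : hausdorffGauge h (Set.univ : Set (∀ n, V n)) + 1 ≠ ⊤ :=
    ENNReal.add_ne_top.2 ⟨hne, ENNReal.one_ne_top⟩
  obtain ⟨n, hn⟩ := pow_unbounded_of_one_lt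
    (18 * (hausdorffGauge h (Set.univ : Set (∀ n, V n)) + 1).toReal) (one_lt_two)
  have h1 := (ENNReal.ofReal_le_iff_le_toReal hne').1 (hkey (n+1))
  have h2 := hNgrow n
  linarith
end

section
/- With the Davies–Rogers construction data (graphs G_n satisfying (i) and (ii), space Ω, metric ρ, gauge h as in the context), for every subset A ⊆ Ω, either H^h(A) = 0 or H^h(A) = ∞. -/
open Set ENNReal Finset

open MeasureTheory in
lemma gauge_eq {X : Type*} [MetricSpace X] [MeasurableSpace X] [BorelSpace X] (f : ℝ → ℝ)
    (f0 : f 0 = 0) (A : Set X) :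
    hausdorffGauge f A =
      Measure.mkMetric (fun d : ℝ≥0∞ => ENNReal.ofReal (f d.toReal)) A := by
  rw [Measure.mkMetric_apply]
  have key : ∀ t : Set X, (⨆ _ : t.Nonempty, ENNReal.ofReal (f (Metric.ediam t).toReal)) =
      ENNReal.ofReal (f (Metric.ediam t).toReal) := by
    intro t
    rcases t.eq_empty_or_nonempty with rfl | ht
    · simp [f0]
    · simp [ht]
  simp only [key]
  unfold hausdorffGauge hausdorffApprox
  apply le_antisymm
  · refine iSup₂_le fun δ hδ => ?_
    exact le_iSup₂_of_le (ENNReal.ofReal δ) (by simpa using hδ) le_rfl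
  · refine iSup₂_le fun r hr => ?_
    by_cases hr' : r = ⊤
    · subst hr'
      refine le_iSup₂_of_le 1 one_pos ?_
      refine le_iInf fun C => le_iInf fun h1 => le_iInf fun h2 => ?_
      exact iInf_le_of_le C (iInf_le_of_le h1 (iInf_le_of_le (fun n => le_top) le_rfl))
    · refine le_iSup₂_of_le r.toReal (ENNReal.toReal_pos hr.ne' hr') ?_
      rw [ENNReal.ofReal_toReal hr']
      exact le_rfl

open MeasureTheory PiNat in
lemma null_part (V : ℕ → Type) [∀ n, Fintype (V n)] [∀ n, Nonempty (V n)]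
    [MeasurableSpace (∀ n, V n)] (ν : Measure (∀ n, V n)) (a : ℕ → ℝ≥0∞)
    (ha : ∀ n, (∏ k : Fin n, (Fintype.card (V k) : ℝ≥0∞)) * a n ≤ (2⁻¹ : ℝ≥0∞) ^ n)
    (n0 : ℕ) (D : Set (∀ n, V n))
    (hD : ∀ x ∈ D, ∀ n, n0 ≤ n → ν (cylinder x n) ≤ 8 * a n) : ν D = 0 := by
  have h1 : ∀ n, n0 ≤ n → ν D ≤ 8 * (2⁻¹ : ℝ≥0∞) ^ n := by
    intro n hn
    let E : (∀ k : Fin n, V k) → Set (∀ n, V n) := fun t => {x | x ∈ D ∧ ∀ k : Fin n, x k = t k}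
    have hsub : D ⊆ ⋃ t, E t := fun x hx => mem_iUnion.2 ⟨fun k => x k, hx, fun k => rfl⟩
    have hE : ∀ t, ν (E t) ≤ 8 * a n := by
      intro t
      rcases (E t).eq_empty_or_nonempty with h | ⟨x, hx⟩
      · simp [h]
      · refine le_trans (measure_mono ?_) (hD x hx.1 n hn)
        intro y hy i hi
        rw [hy.2 ⟨i, hi⟩, hx.2 ⟨i, hi⟩]
    calc ν D ≤ ν (⋃ t, E t) := measure_mono hsub
      _ ≤ ∑ t, ν (E t) := measure_iUnion_fintype_le _ _
      _ ≤ ∑ t : (∀ k : Fin n, V k), 8 * a n := Finset.sum_le_sum fun t _ => hE t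
      _ = 8 * ((∏ k : Fin n, (Fintype.card (V k) : ℝ≥0∞)) * a n) := by
        rw [Finset.sum_const, Finset.card_univ, Fintype.card_pi, nsmul_eq_mul]
        push_cast
        ring
      _ ≤ _ := by gcongr; exact ha n
  have ht : Filter.Tendsto (fun n : ℕ => 8 * (2⁻¹ : ℝ≥0∞) ^ n) Filter.atTop (nhds (8 * 0)) := by
    apply ENNReal.Tendsto.const_mul
    · exact ENNReal.tendsto_pow_atTop_nhds_zero_of_lt_one (by simp)
    · right; simp
  rw [mul_zero] at ht
  exact le_antisymm (ge_of_tendsto ht (Filter.eventually_atTop.2 ⟨n0, h1⟩)) bot_le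

open MeasureTheory PiNat in
lemma dr_core_s10 (V : ℕ → Type) [∀ n, Fintype (V n)] [∀ n, Nonempty (V n)]
    (G : ∀ n, SimpleGraph (V n)) (a : ℕ → ℝ≥0∞)
    (ha : ∀ n, (∏ k : Fin n, (Fintype.card (V k) : ℝ≥0∞)) * a n ≤ (2⁻¹ : ℝ≥0∞) ^ n)
    (hweight : ∀ n, ∀ w : V n → ℝ, (∀ v, 0 ≤ w v) →
      ∃ H : Finset (V n), IsIndepSet (G n) ↑H ∧
        (1 / 4 : ℝ) * ∑ g : V n, w g ≤ ∑ g ∈ H, w g)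
    [MetricSpace (∀ n, V n)] [MeasurableSpace (∀ n, V n)] [BorelSpace (∀ n, V n)]
    (hopen : ∀ (x : ∀ n, V n) n, IsOpen (cylinder x n)) (m : ℝ≥0∞ → ℝ≥0∞)
    (hC : ∀ (x : ∀ n, V n) n (H : Finset (V n)), IsIndepSet (G n) (H : Set (V n)) →
      Metric.ediam {y | y ∈ cylinder x n ∧ y n ∈ H} ≤ (2⁻¹ : ℝ≥0∞) ^ n ∧
      m (Metric.ediam {y | y ∈ cylinder x n ∧ y n ∈ H}) ≤ a n)
    (A : Set (∀ n, V n)) (hA : (Measure.mkMetric m : Measure (∀ n, V n)) A ≠ ⊤) :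
    (Measure.mkMetric m : Measure (∀ n, V n)) A = 0 := by
  classical
  set μ : Measure (∀ n, V n) := Measure.mkMetric m with hμ
  set ν := μ.restrict A with hν
  have hνu : ν univ = μ A := by simp [hν]
  haveI : IsFiniteMeasure ν := ⟨by rw [hνu]; exact lt_top_iff_ne_top.2 hA⟩
  have hcoord : ∀ n (g : V n), IsOpen {y : ∀ n, V n | y n = g} := by
    intro n g
    have : {y : ∀ n, V n | y n = g} = ⋃ x ∈ {y : ∀ n, V n | y n = g}, cylinder x (n + 1) := by
      ext y
      simp only [mem_iUnion, mem_setOf_eq]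
      constructor
      · intro hy; exact ⟨y, hy, self_mem_cylinder _ _⟩
      · rintro ⟨x, hx, hy⟩
        rw [hy n (Nat.lt_succ_self n), hx]
    rw [this]
    exact isOpen_biUnion fun x _ => hopen x _
  -- choose the independent sets
  have hH : ∀ n (S : Set (∀ n, V n)), ∃ H : Finset (V n), IsIndepSet (G n) (H : Set (V n)) ∧
      (MeasurableSet S → ν S ≤ 4 * ν {y | y ∈ S ∧ y n ∈ H}) := by
    intro n S
    obtain ⟨H, hH1, hH2⟩ := hweight n (fun g => (ν (S ∩ {y | y n = g})).toReal)
      (fun _ => ENNReal.toReal_nonneg)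
    refine ⟨H, hH1, fun hS => ?_⟩
    have e1 : ν S ≤ ∑ g, ν (S ∩ {y | y n = g}) := by
      refine le_trans (measure_mono ?_) (measure_iUnion_fintype_le ν _)
      intro y hy
      exact mem_iUnion.2 ⟨y n, hy, rfl⟩
    have e2 : ν {y | y ∈ S ∧ y n ∈ H} = ∑ g ∈ H, ν (S ∩ {y | y n = g}) := by
      rw [← measure_biUnion_finset]
      · congr 1
        ext y
        simp
      · intro g _ g' _ hne
        rw [Function.onFun, Set.disjoint_left]
        rintro y ⟨_, h1⟩ ⟨_, h2⟩
        exact hne (h1.symm.trans h2)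
      · intro g _
        exact hS.inter (hcoord n g).measurableSet
    rw [← ENNReal.toReal_sum (fun _ _ => measure_ne_top _ _),
      ← ENNReal.toReal_sum (fun _ _ => measure_ne_top _ _), ← e2] at hH2
    have e3 : (ν S).toReal ≤ (∑ g, ν (S ∩ {y | y n = g})).toReal :=
      ENNReal.toReal_mono (ENNReal.sum_ne_top.2 fun _ _ => measure_ne_top _ _) e1
    rw [← ENNReal.toReal_le_toReal (measure_ne_top _ _)
      (ENNReal.mul_ne_top (by simp) (measure_ne_top _ _)), ENNReal.toReal_mul]
    have : (4 : ℝ≥0∞).toReal = 4 := by simp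
    rw [this]
    linarith
  choose H hHi hHm using hH
  -- main estimate
  have main : ∀ r : ℝ≥0∞, 0 < r →
      OuterMeasure.mkMetric'.pre (fun s : Set (∀ n, V n) => m (Metric.ediam s)) r A
        ≤ μ A - (1 / 8) * μ A := by
    intro r hr
    set P := OuterMeasure.mkMetric'.pre (fun s : Set (∀ n, V n) => m (Metric.ediam s)) r with hP
    have hPμ : ∀ s, P s ≤ μ s := by
      intro s
      rw [hμ, ← OuterMeasure.coe_mkMetric]
      have : P ≤ OuterMeasure.mkMetric m := by
        unfold OuterMeasure.mkMetric OuterMeasure.mkMetric'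
        exact le_iSup₂_of_le r hr le_rfl
      exact this s
    obtain ⟨n0, hn0⟩ : ∃ n0 : ℕ, (2⁻¹ : ℝ≥0∞) ^ n0 < r :=
      ENNReal.exists_inv_two_pow_lt hr.ne'
    have hn0' : ∀ n, n0 ≤ n → (2⁻¹ : ℝ≥0∞) ^ n ≤ r := fun n hn =>
      le_trans (pow_le_pow_right_of_le_one' (by simp) hn) hn0.le
    let FB : (∀ n, V n) → ℕ → Prop := fun x n => n0 ≤ n ∧ 8 * a n < ν (cylinder x n) ∧
      ∀ k, n0 ≤ k → k < n → ¬ 8 * a k < ν (cylinder x k)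
    let T : Set (ℕ × Set (∀ n, V n)) := {p | ∃ x, p.2 = cylinder x p.1 ∧ FB x p.1}
    let C : ℕ × Set (∀ n, V n) → Set (∀ n, V n) := fun p => {y | y ∈ p.2 ∧ y p.1 ∈ H p.1 p.2}
    have hTc : T.Countable := by
      have : T ⊆ range (fun q : (Σ n : ℕ, ∀ k : Fin n, V k) =>
          (q.1, {y : ∀ n, V n | ∀ k : Fin q.1, y k = q.2 k})) := by
        rintro ⟨n, S⟩ ⟨x, hx, -⟩
        refine ⟨⟨n, fun k => x k⟩, ?_⟩
        simp only at hx
        subst hx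
        simp only [Prod.mk.injEq, true_and]
        ext y
        exact ⟨fun h i hi => h ⟨i, hi⟩, fun h k => h k k.2⟩
      exact (countable_range _).mono this
    have hFB : ∀ (x z : ∀ n, V n) (n : ℕ), z ∈ cylinder x n → FB x n → FB z n := by
      rintro x z n hz ⟨h1, h2, h3⟩
      refine ⟨h1, ?_, fun k hk hkn => ?_⟩
      · rwa [mem_cylinder_iff_eq.1 hz]
      · rw [mem_cylinder_iff_eq.1 (cylinder_anti x hkn.le hz)]
        exact h3 k hk hkn
    have hTd : T.PairwiseDisjoint (fun p => p.2) := by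
      rintro ⟨n, S⟩ ⟨x, hx, hFx⟩ ⟨n', S'⟩ ⟨x', hx', hFx'⟩ hne
      rw [Function.onFun, Set.disjoint_left]
      intro z hz hz'
      simp only at hx hx' hFx hFx' hz hz'
      subst hx hx'
      have f1 := hFB _ _ _ hz hFx
      have f2 := hFB _ _ _ hz' hFx'
      have : n = n' := by
        rcases lt_trichotomy n n' with h | h | h
        · exact absurd f1.2.1 (f2.2.2 n f1.1 h)
        · exact h
        · exact absurd f2.2.1 (f1.2.2 n' f2.1 h)
      subst this
      rw [← mem_cylinder_iff_eq.1 hz, ← mem_cylinder_iff_eq.1 hz'] at hne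
      exact hne rfl
    have hTm : ∀ p ∈ T, MeasurableSet p.2 := by
      rintro ⟨n, S⟩ ⟨x, hx, -⟩
      simp only at hx ⊢
      rw [hx]
      exact (hopen x n).measurableSet
    have hCm : ∀ p ∈ T, MeasurableSet (C p) := by
      intro p hp
      have : C p = p.2 ∩ ⋃ g ∈ H p.1 p.2, {y | y p.1 = g} := by
        ext y; simp [C]
      rw [this]
      exact (hTm p hp).inter
        (isOpen_biUnion fun g _ => hcoord p.1 g).measurableSet
    have hCd : T.PairwiseDisjoint C := hTd.mono (fun p y hy => hy.1)
    set U := ⋃ p ∈ T, C p with hU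
    have hUm : MeasurableSet U := MeasurableSet.biUnion hTc hCm
    have hνU : ν U = ∑' p : T, ν (C p) := measure_biUnion hTc hCd hCm
    have hνT : ν (⋃ p ∈ T, p.2) = ∑' p : T, ν (p : ℕ × Set (∀ n, V n)).2 :=
      measure_biUnion hTc hTd hTm
    have hnull : ν (⋃ p ∈ T, p.2)ᶜ = 0 := by
      refine null_part V ν a ha n0 _ ?_
      intro x hx n hn
      by_contra hcon
      rw [not_le] at hcon
      apply hx
      have hex : ∃ n, n0 ≤ n ∧ 8 * a n < ν (cylinder x n) := ⟨n, hn, hcon⟩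
      have hs := Nat.find_spec hex
      refine mem_biUnion (x := (Nat.find hex, cylinder x (Nat.find hex)))
        ⟨x, rfl, hs.1, hs.2, fun k hk hkn hb => Nat.find_min hex hkn ⟨hk, hb⟩⟩ ?_
      exact self_mem_cylinder _ _
    have hfull : μ A ≤ 4 * ν U := by
      calc μ A = ν univ := hνu.symm
        _ ≤ ν (⋃ p ∈ T, p.2) + ν (⋃ p ∈ T, p.2)ᶜ := by
          rw [← union_compl_self (⋃ p ∈ T, p.2)]; exact measure_union_le _ _
        _ = ∑' p : T, ν (p : ℕ × Set (∀ n, V n)).2 := by rw [hnull, add_zero, hνT]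
        _ ≤ ∑' p : T, 4 * ν (C p) :=
          ENNReal.tsum_le_tsum fun p => hHm _ _ (hTm p p.2)
        _ = 4 * ν U := by rw [ENNReal.tsum_mul_left, hνU]
    have hcost : ∀ p ∈ T, 2 * P (C p) ≤ ν (C p) := by
      rintro ⟨n, S⟩ hp
      have hm1 := hHm n S (hTm _ hp)
      obtain ⟨x, hx, hF⟩ := hp
      simp only at hx hF
      subst hx
      have hc := hC x n (H n (cylinder x n)) (hHi _ _)
      have p1 : P (C (n, cylinder x n)) ≤ a n :=
        le_trans (OuterMeasure.mkMetric'.le_pre.1 le_rfl _ (hc.1.trans (hn0' n hF.1))) hc.2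
      have p2 : 4 * (2 * P (C (n, cylinder x n))) ≤ 4 * ν (C (n, cylinder x n)) := by
        calc 4 * (2 * P (C (n, cylinder x n))) = 8 * P (C (n, cylinder x n)) := by ring
          _ ≤ 8 * a n := by gcongr
          _ ≤ _ := hF.2.1.le
          _ ≤ _ := hm1
      exact (ENNReal.mul_le_mul_iff_right (by simp) (by simp)).1 p2
    have hPU : 2 * P U ≤ ν U := by
      calc 2 * P U ≤ 2 * ∑' p : T, P (C p) := by
            gcongr; exact measure_biUnion_le P hTc C
        _ = ∑' p : T, 2 * P (C p) := by rw [ENNReal.tsum_mul_left]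
        _ ≤ ∑' p : T, ν (C p) := ENNReal.tsum_le_tsum fun p => hcost p p.2
        _ = ν U := hνU.symm
    have hsplit : μ (A ∩ U) + μ (A \ U) = μ A := measure_inter_add_diff A hUm
    have hνU' : ν U = μ (A ∩ U) := by rw [hν, Measure.restrict_apply hUm, inter_comm]
    have hPA : P A ≤ P U + μ (A \ U) := by
      calc P A ≤ P (U ∪ A \ U) := P.mono (by intro y hy; by_cases h : y ∈ U <;> simp [h, hy])
        _ ≤ P U + P (A \ U) := measure_union_le _ _
        _ ≤ _ := by gcongr; exact hPμ _
    rw [hνU'] at hPU hfull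
    have f1 : μ (A ∩ U) ≠ ⊤ := ne_top_of_le_ne_top hA (measure_mono inter_subset_left)
    have f2 : μ (A \ U) ≠ ⊤ := ne_top_of_le_ne_top hA (measure_mono sdiff_subset)
    have f3 : P U ≠ ⊤ := by
      intro h
      rw [h] at hPU
      exact f1 (by simpa using hPU)
    refine hPA.trans ?_
    generalize P U = u at *
    rw [← hsplit] at hfull ⊢
    generalize μ (A ∩ U) = b at *
    generalize μ (A \ U) = c at *
    lift b to NNReal using f1
    lift c to NNReal using f2
    lift u to NNReal using f3
    have hfull' : (b : ℝ) + c ≤ 4 * b := by exact_mod_cast hfull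
    have hPU' : 2 * (u : ℝ) ≤ b := by exact_mod_cast hPU
    refine ENNReal.le_sub_of_add_le_right ?_ ?_
    · exact ENNReal.mul_ne_top (by simp) (by simp)
    · rw [← ENNReal.toReal_le_toReal]
      · simp [ENNReal.toReal_add, ENNReal.mul_ne_top]
        linarith
      · simp [ENNReal.mul_ne_top]
      · simp
  have hle : μ A ≤ μ A - (1 / 8) * μ A := by
    conv_lhs => rw [hμ, ← OuterMeasure.coe_mkMetric]
    unfold OuterMeasure.mkMetric OuterMeasure.mkMetric'
    simp only [OuterMeasure.iSup_apply]
    exact iSup₂_le fun r hr => main r hr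
  generalize μ A = t at *
  by_contra h0
  have : t - 1 / 8 * t < t := ENNReal.sub_lt_self hA h0 (by simp [h0])
  exact absurd hle (not_le.2 this)

lemma dr_gauge_mono (M : ℕ → ℕ) (hM : ∀ k, 1 ≤ M k) (h : ℝ → ℝ) (hh0 : h 0 = 0)
    (hhval : ∀ n : ℕ,
      h ((2 : ℝ) ^ (-(n : ℤ))) = 1 / ∏ k ∈ Finset.range (n + 1), (M k : ℝ))
    (hlin : ∀ n : ℕ, ∀ t : ℝ, (2 : ℝ) ^ (-(n : ℤ) - 1) ≤ t → t ≤ (2 : ℝ) ^ (-(n : ℤ)) →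
      h t = h ((2 : ℝ) ^ (-(n : ℤ) - 1)) +
        (t - (2 : ℝ) ^ (-(n : ℤ) - 1)) *
          (h ((2 : ℝ) ^ (-(n : ℤ))) - h ((2 : ℝ) ^ (-(n : ℤ) - 1))) /
            ((2 : ℝ) ^ (-(n : ℤ)) - (2 : ℝ) ^ (-(n : ℤ) - 1)))
    (n : ℕ) (t : ℝ) (ht0 : 0 ≤ t) (ht : t ≤ (2 : ℝ) ^ (-(n : ℤ))) :
    h t ≤ h ((2 : ℝ) ^ (-(n : ℤ))) := by
  have hMr : ∀ k, (1 : ℝ) ≤ M k := fun k => by exact_mod_cast hM k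
  have hpos : ∀ n : ℕ, 0 < ∏ k ∈ Finset.range (n + 1), (M k : ℝ) := fun n =>
    Finset.prod_pos fun k _ => lt_of_lt_of_le one_pos (hMr k)
  have hanti : Antitone (fun n : ℕ => h ((2 : ℝ) ^ (-(n : ℤ)))) := by
    refine antitone_nat_of_succ_le fun n => ?_
    rw [hhval, hhval, Finset.prod_range_succ _ (n + 1)]
    apply one_div_le_one_div_of_le (hpos n)
    exact le_mul_of_one_le_right (hpos n).le (hMr _)
  rcases ht0.eq_or_lt with rfl | ht0
  · rw [hh0, hhval]
    exact (one_div_pos.2 (hpos n)).le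
  have ht1 : t ≤ 1 := ht.trans (zpow_le_one_of_nonpos₀ (by norm_num) (by simp))
  obtain ⟨k, hk1, hk2⟩ := exists_nat_pow_near_of_lt_one ht0 ht1
    (by norm_num : (0 : ℝ) < 2⁻¹) (by norm_num)
  have z1 : ∀ k : ℕ, (2⁻¹ : ℝ) ^ k = (2 : ℝ) ^ (-(k : ℤ)) := fun k => by
    rw [zpow_neg, zpow_natCast, inv_pow]
  have z2 : (2 : ℝ) ^ (-(k : ℤ) - 1) = (2 : ℝ) ^ (-((k + 1 : ℕ) : ℤ)) := by
    congr 1; push_cast; ring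
  rw [z1, ← z2] at hk1
  rw [z1] at hk2
  have hkn : n ≤ k := by
    by_contra hc
    rw [not_le] at hc
    have : (2 : ℝ) ^ (-(n : ℤ)) ≤ (2 : ℝ) ^ (-(k : ℤ) - 1) :=
      zpow_le_zpow_right₀ (by norm_num) (by omega)
    linarith
  refine le_trans ?_ (hanti hkn)
  rw [hlin k t hk1.le hk2]
  have hA : h ((2 : ℝ) ^ (-(k : ℤ) - 1)) ≤ h ((2 : ℝ) ^ (-(k : ℤ))) := by
    rw [z2]; exact hanti (Nat.le_succ k)
  have hd : 0 < (2 : ℝ) ^ (-(k : ℤ)) - (2 : ℝ) ^ (-(k : ℤ) - 1) := by linarith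
  simp only
  generalize h ((2 : ℝ) ^ (-(k : ℤ) - 1)) = p at *
  generalize h ((2 : ℝ) ^ (-(k : ℤ))) = q at *
  have : (t - (2 : ℝ) ^ (-(k : ℤ) - 1)) * (q - p) /
      ((2 : ℝ) ^ (-(k : ℤ)) - (2 : ℝ) ^ (-(k : ℤ) - 1)) ≤ q - p := by
    rw [div_le_iff₀ hd, mul_comm]
    apply mul_le_mul_of_nonneg_left <;> linarith
  linarith

/-- With the Davies–Rogers construction data (graphs `G n` on vertex sets
`V n` satisfying (i) and (ii), the product space `Ω = Π n, V n` with metric `ρ`, and the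
gauge `h`), every subset of `Ω` has `h`-Hausdorff measure either `0` or `∞`. -/
theorem statement10
    -- the vertex sets and graphs
    (V : ℕ → Type) [∀ n, Fintype (V n)] [∀ n, Nonempty (V n)]
    (G : ∀ n, SimpleGraph (V n))
    -- the sequence M with M 0 = 1 and M (n+1) = 2 · N n, where N n = |V (G n)|
    (M : ℕ → ℕ) (hM0 : M 0 = 1) (hMsucc : ∀ n, M (n + 1) = 2 * Fintype.card (V n))
    -- (i): the vertex set of `G n` cannot be partitioned into `M n` independent sets
    (hpart : ∀ n, ¬ ∃ p : V n → Fin (M n), ∀ i : Fin (M n), IsIndepSet (G n) {v | p v = i})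
    -- (ii): the weighted independent-set property
    (hweight : ∀ n, ∀ w : V n → ℝ, (∀ v, 0 ≤ w v) →
      ∃ H : Finset (V n), IsIndepSet (G n) ↑H ∧
        (1 / 4 : ℝ) * ∑ g : V n, w g ≤ ∑ g ∈ H, w g)
    -- the metric ρ on Ω
    [MetricSpace (∀ n, V n)]
    (hdist_adj : ∀ x y : ∀ n, V n, ∀ n : ℕ, (∀ k, k < n → x k = y k) → x n ≠ y n →
      (G n).Adj (x n) (y n) → dist x y = (2 : ℝ) ^ (1 - (n : ℤ)))
    (hdist_nadj : ∀ x y : ∀ n, V n, ∀ n : ℕ, (∀ k, k < n → x k = y k) → x n ≠ y n →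
      ¬ (G n).Adj (x n) (y n) → dist x y = (2 : ℝ) ^ (-(n : ℤ)))
    -- the gauge function h
    (h : ℝ → ℝ) (hh0 : h 0 = 0)
    (hhval : ∀ n : ℕ,
      h ((2 : ℝ) ^ (-(n : ℤ))) = 1 / ∏ k ∈ Finset.range (n + 1), (M k : ℝ))
    (hlin : ∀ n : ℕ, ∀ t : ℝ, (2 : ℝ) ^ (-(n : ℤ) - 1) ≤ t → t ≤ (2 : ℝ) ^ (-(n : ℤ)) →
      h t = h ((2 : ℝ) ^ (-(n : ℤ) - 1)) +
        (t - (2 : ℝ) ^ (-(n : ℤ) - 1)) *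
          (h ((2 : ℝ) ^ (-(n : ℤ))) - h ((2 : ℝ) ^ (-(n : ℤ) - 1))) /
            ((2 : ℝ) ^ (-(n : ℤ)) - (2 : ℝ) ^ (-(n : ℤ) - 1)))
    (hone : ∀ t : ℝ, 1 ≤ t → h t = 1) :
    ∀ A : Set (∀ n, V n), hausdorffGauge h A = 0 ∨ hausdorffGauge h A = ⊤ := by
  classical
  intro A
  letI : MeasurableSpace (∀ n, V n) := borel _
  haveI : BorelSpace (∀ n, V n) := ⟨rfl⟩
  have hM : ∀ k, 1 ≤ M k := by
    intro k
    rcases k with _ | k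
    · rw [hM0]
    · rw [hMsucc]
      have : 0 < Fintype.card (V k) := Fintype.card_pos
      omega
  have hMr : ∀ k, (1 : ℝ) ≤ M k := fun k => by exact_mod_cast hM k
  have hpos : ∀ n : ℕ, 0 < ∏ k ∈ Finset.range (n + 1), (M k : ℝ) := fun n =>
    Finset.prod_pos fun k _ => lt_of_lt_of_le one_pos (hMr k)
  -- distances
  have hlow : ∀ x y : ∀ n, V n, ∀ n : ℕ, dist x y < (2 : ℝ) ^ (-(n : ℤ)) → y ∈ PiNat.cylinder x n := by
    intro x y n hxy
    by_cases hne : x = y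
    · subst hne; exact PiNat.self_mem_cylinder _ _
    have h1 : ∀ k, k < PiNat.firstDiff x y → x k = y k :=
      fun k hk => PiNat.apply_eq_of_lt_firstDiff hk
    have h2 := PiNat.apply_firstDiff_ne hne
    have h3 : (2 : ℝ) ^ (-(PiNat.firstDiff x y : ℤ)) ≤ dist x y := by
      by_cases hadj : (G _).Adj (x (PiNat.firstDiff x y)) (y (PiNat.firstDiff x y))
      · rw [hdist_adj x y _ h1 h2 hadj]
        exact zpow_le_zpow_right₀ (by norm_num) (by omega)
      · rw [hdist_nadj x y _ h1 h2 hadj]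
    have h4 := (zpow_lt_zpow_iff_right₀ (by norm_num : (1 : ℝ) < 2)).1 (h3.trans_lt hxy)
    intro i hi
    exact (h1 i (by omega)).symm
  have hopen : ∀ (x : ∀ n, V n) n, IsOpen (PiNat.cylinder x n) := by
    intro x n
    rw [Metric.isOpen_iff]
    intro y hy
    refine ⟨(2 : ℝ) ^ (-(n : ℤ)), by positivity, fun z hz => ?_⟩
    rw [← PiNat.mem_cylinder_iff_eq.1 hy]
    apply hlow
    rw [dist_comm]
    exact hz
  have hdiam : ∀ (x : ∀ n, V n) n (H : Finset (V n)), IsIndepSet (G n) (H : Set (V n)) →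
      Metric.ediam {y | y ∈ PiNat.cylinder x n ∧ y n ∈ H} ≤
        ENNReal.ofReal ((2 : ℝ) ^ (-(n : ℤ))) := by
    intro x n H hH
    refine Metric.ediam_le ?_
    rintro y ⟨hy, hyH⟩ z ⟨hz, hzH⟩
    rw [edist_dist]
    apply ENNReal.ofReal_le_ofReal
    by_cases hne : y = z
    · subst hne; rw [dist_self]; positivity
    have h1 : ∀ k, k < PiNat.firstDiff y z → y k = z k :=
      fun k hk => PiNat.apply_eq_of_lt_firstDiff hk
    have h2 := PiNat.apply_firstDiff_ne hne
    have h3 : n ≤ PiNat.firstDiff y z := by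
      by_contra hc
      rw [not_le] at hc
      exact h2 ((hy _ hc).trans (hz _ hc).symm)
    generalize PiNat.firstDiff y z = k at *
    by_cases hadj : (G k).Adj (y k) (z k)
    · rw [hdist_adj y z _ h1 h2 hadj]
      have : n ≠ k := by
        rintro rfl
        exact hH _ hyH _ hzH hadj
      exact zpow_le_zpow_right₀ (by norm_num) (by omega)
    · rw [hdist_nadj y z _ h1 h2 hadj]
      exact zpow_le_zpow_right₀ (by norm_num) (by omega)
  have hpow : ∀ n : ℕ, ENNReal.ofReal ((2 : ℝ) ^ (-(n : ℤ))) = (2⁻¹ : ℝ≥0∞) ^ n := by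
    intro n
    rw [zpow_neg, zpow_natCast, ← inv_pow, ENNReal.ofReal_pow (by norm_num),
      ENNReal.ofReal_inv_of_pos (by norm_num)]
    simp
  rw [gauge_eq h hh0 A, or_iff_not_imp_right]
  intro hA
  refine dr_core_s10 V G (fun n => ENNReal.ofReal (h ((2 : ℝ) ^ (-(n : ℤ))))) ?_ hweight hopen _ ?_ A hA
  · intro n
    have hprod : (∏ k : Fin n, (Fintype.card (V k) : ℝ)) * 2 ^ n =
        ∏ k ∈ Finset.range (n + 1), (M k : ℝ) := by
      rw [Finset.prod_range_succ', hM0, Fin.prod_univ_eq_prod_range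
        (fun k => (Fintype.card (V k) : ℝ)) n]
      simp only [hMsucc]
      push_cast
      rw [Finset.prod_mul_distrib]
      simp [mul_comm]
    have hcast : (∏ k : Fin n, (Fintype.card (V k) : ℝ≥0∞)) =
        ENNReal.ofReal (∏ k : Fin n, (Fintype.card (V k) : ℝ)) := by
      rw [ENNReal.ofReal_prod_of_nonneg (fun _ _ => Nat.cast_nonneg _)]
      simp
    rw [hcast, ← ENNReal.ofReal_mul (Finset.prod_nonneg fun _ _ => Nat.cast_nonneg _),
      ← hpow]
    apply ENNReal.ofReal_le_ofReal
    rw [hhval, ← hprod, zpow_neg, zpow_natCast]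
    have : 0 < ∏ k : Fin n, (Fintype.card (V k) : ℝ) :=
      Finset.prod_pos fun k _ => by exact_mod_cast Fintype.card_pos
    apply le_of_eq
    field_simp
  · intro x n H hH
    have hd := hdiam x n H hH
    refine ⟨(hpow n) ▸ hd, ?_⟩
    apply ENNReal.ofReal_le_ofReal
    apply dr_gauge_mono M hM h hh0 hhval hlin n _ ENNReal.toReal_nonneg
    exact ENNReal.toReal_le_of_le_ofReal (by positivity) hd
end

section
/- With the Davies–Rogers construction data (graphs G_n satisfying (i), (ii) and (iii), space Ω, metric ρ, gauge h as in the context), let N^h_Ω = { A ⊆ Ω : H^h(A) = 0 } and let E be the σ-ideal on Cantor space 2^ω generated by closed sets that are null for the uniform coin-flipping product probability measure. Then cov(N^h_Ω) ≤ non(E) and cov(E) ≤ non(N^h_Ω). -/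
open Set ENNReal Finset

/-- `cov(I)`: the least cardinality of a subfamily of `I` covering the whole space. -/
noncomputable def covIdeal {α : Type} (I : Set (Set α)) : Cardinal :=
  sInf {c : Cardinal | ∃ F : Set (Set α), F ⊆ I ∧ ⋃₀ F = Set.univ ∧ c = Cardinal.mk F}

/-- `non(I)`: the least cardinality of a subset of the space not belonging to `I`. -/
noncomputable def nonIdeal {α : Type} (I : Set (Set α)) : Cardinal :=
  sInf {c : Cardinal | ∃ A : Set α, A ∉ I ∧ c = Cardinal.mk A}

/-- The σ-ideal `E` on Cantor space generated by closed `μ`-null sets. -/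
def closedNullIdeal (μ : MeasureTheory.Measure (ℕ → Bool)) : Set (Set (ℕ → Bool)) :=
  {A : Set (ℕ → Bool) | ∃ C : ℕ → Set (ℕ → Bool),
    (∀ n, IsClosed (C n) ∧ μ (C n) = 0) ∧ A ⊆ ⋃ n, C n}


lemma aux_card {N : ℕ} (hN : 0 < N) : N ≤ 2 ^ Nat.clog 2 N ∧ 2 ^ Nat.clog 2 N ≤ 2 * N := by
  refine ⟨Nat.le_pow_clog (by norm_num) N, ?_⟩
  rcases Nat.lt_or_ge 1 N with h | h
  · have := Nat.pow_pred_clog_lt_self (b := 2) (by norm_num) h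
    have h2 : 0 < Nat.clog 2 N := Nat.clog_pos (by norm_num) h
    obtain ⟨c, hc⟩ : ∃ c, Nat.clog 2 N = c + 1 := ⟨Nat.clog 2 N - 1, by omega⟩
    rw [hc] at this ⊢
    simp at this
    rw [pow_succ]; omega
  · have : N = 1 := by omega
    subst this; simp

lemma aux_surj (V : Type) [Fintype V] [Nonempty V] :
    ∃ (k : ℕ) (f : (Fin k → Bool) → V), Function.Surjective f ∧ 2 ^ k ≤ 2 * Fintype.card V := by
  obtain ⟨h1, h2⟩ := aux_card (N := Fintype.card V) Fintype.card_pos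
  refine ⟨Nat.clog 2 (Fintype.card V), ?_⟩
  have : Nonempty (V ↪ (Fin (Nat.clog 2 (Fintype.card V)) → Bool)) :=
    Function.Embedding.nonempty_of_card_le (by simpa using h1)
  obtain ⟨g⟩ := this
  exact ⟨Function.invFun g, Function.invFun_surjective g.injective, h2⟩

lemma aux_null (μ : MeasureTheory.Measure (ℕ → Bool))
    (hμ : ∀ (s : Finset ℕ) (y : ℕ → Bool),
      μ {x : ℕ → Bool | ∀ i ∈ s, x i = y i} = (1 / 2 : ℝ≥0∞) ^ s.card)
    (k a : ℕ → ℕ) (ha : ∀ n, a (n + 1) = a n + k n)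
    (B : ∀ n, Finset (Fin (k n) → Bool)) (hB : ∀ n, 8 * (B n).card ≤ 7 * 2 ^ (k n)) (m : ℕ) :
    μ {x : ℕ → Bool | ∀ n ≥ m, (fun i : Fin (k n) => x (a n + i)) ∈ B n} = 0 := by
  have key : ∀ j m : ℕ, ∀ z : ℕ → Bool,
      μ {x : ℕ → Bool | (∀ i ∈ Finset.range (a m), x i = z i) ∧
        ∀ n, m ≤ n → n < m + j → (fun i : Fin (k n) => x (a n + i)) ∈ B n}
        ≤ (7 / 8 : ℝ≥0∞) ^ j * (1 / 2 : ℝ≥0∞) ^ (a m) := by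
    intro j
    induction j with
    | zero =>
      intro m z
      have := hμ (Finset.range (a m)) z
      rw [Finset.card_range] at this
      rw [pow_zero, one_mul, ← this]
      exact MeasureTheory.measure_mono (fun x hx => hx.1)
    | succ j ih =>
      intro m z
      let ext : (Fin (k m) → Bool) → ℕ → Bool := fun t i =>
        if h : a m ≤ i ∧ i - a m < k m then t ⟨i - a m, h.2⟩ else z i
      have hsub : {x : ℕ → Bool | (∀ i ∈ Finset.range (a m), x i = z i) ∧
        ∀ n, m ≤ n → n < m + (j + 1) → (fun i : Fin (k n) => x (a n + i)) ∈ B n} ⊆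
        ⋃ t ∈ B m, {x : ℕ → Bool | (∀ i ∈ Finset.range (a (m+1)), x i = ext t i) ∧
        ∀ n, m + 1 ≤ n → n < m + 1 + j → (fun i : Fin (k n) => x (a n + i)) ∈ B n} := by
        rintro x ⟨hx1, hx2⟩
        simp only [Set.mem_iUnion, Set.mem_setOf_eq]
        refine ⟨_, hx2 m le_rfl (by omega), ?_, fun n h1 h2 => hx2 n (by omega) (by omega)⟩
        intro i hi
        rw [Finset.mem_range, ha] at hi
        simp only [ext]
        split_ifs with h
        · have : a m + (i - a m) = i := by omega
          simp [this]
        · exact hx1 i (by rw [Finset.mem_range]; omega)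
      refine (MeasureTheory.measure_mono hsub).trans ?_
      refine (MeasureTheory.measure_biUnion_finset_le _ _).trans ?_
      refine (Finset.sum_le_sum (fun t _ => ih (m+1) (ext t))).trans ?_
      rw [Finset.sum_const, nsmul_eq_mul, ha]
      have h1 : ((B m).card : ℝ≥0∞) * (1/2) ^ (k m) ≤ 7 / 8 := by
        have h2 : (8 : ℝ≥0∞) * (B m).card ≤ 7 * 2 ^ (k m) := by exact_mod_cast hB m
        rw [one_div, ← ENNReal.inv_pow, ← div_eq_mul_inv]
        rw [ENNReal.div_le_iff (by simp) (by simp)]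
        rw [← ENNReal.mul_div_right_comm, ENNReal.le_div_iff_mul_le (by simp) (by simp), mul_comm]
        exact h2
      calc ((B m).card : ℝ≥0∞) * ((7 / 8) ^ j * (1 / 2) ^ (a m + k m))
          = (7/8)^j * (1/2)^(a m) * (((B m).card : ℝ≥0∞) * (1/2) ^ (k m)) := by ring
        _ ≤ (7/8)^j * (1/2)^(a m) * (7/8) := by gcongr
        _ = _ := by ring
  have hle : ∀ j, μ {x : ℕ → Bool | ∀ n ≥ m, (fun i : Fin (k n) => x (a n + i)) ∈ B n}
      ≤ 2 ^ (a m) * ((7 / 8 : ℝ≥0∞) ^ j * (1 / 2 : ℝ≥0∞) ^ (a m)) := by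
    intro j
    let ext : (Fin (a m) → Bool) → ℕ → Bool := fun t i =>
        if h : i < a m then t ⟨i, h⟩ else false
    have hsub : {x : ℕ → Bool | ∀ n ≥ m, (fun i : Fin (k n) => x (a n + i)) ∈ B n} ⊆
        ⋃ t ∈ (Finset.univ : Finset (Fin (a m) → Bool)),
          {x : ℕ → Bool | (∀ i ∈ Finset.range (a m), x i = ext t i) ∧
        ∀ n, m ≤ n → n < m + j → (fun i : Fin (k n) => x (a n + i)) ∈ B n} := by
      intro x hx
      simp only [Set.mem_iUnion, Set.mem_setOf_eq]
      refine ⟨fun i => x i, Finset.mem_univ _, ?_, fun n h1 _ => hx n h1⟩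
      intro i hi
      rw [Finset.mem_range] at hi
      simp [ext, hi]
    refine (MeasureTheory.measure_mono hsub).trans ?_
    refine (MeasureTheory.measure_biUnion_finset_le _ _).trans ?_
    refine (Finset.sum_le_sum (fun t _ => key j m (ext t))).trans ?_
    rw [Finset.sum_const, nsmul_eq_mul]
    simp
  have hle2 : ∀ j, μ {x : ℕ → Bool | ∀ n ≥ m, (fun i : Fin (k n) => x (a n + i)) ∈ B n}
      ≤ (7 / 8 : ℝ≥0∞) ^ j := by
    intro j
    refine (hle j).trans (le_of_eq ?_)
    rw [mul_left_comm, ← mul_pow, one_div, ENNReal.mul_inv_cancel (by simp) (by simp), one_pow,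
      mul_one]
  have ht : Filter.Tendsto (fun j : ℕ => (7 / 8 : ℝ≥0∞) ^ j) Filter.atTop (nhds 0) := by
    apply ENNReal.tendsto_pow_atTop_nhds_zero_of_lt_one
    rw [ENNReal.div_lt_iff (by simp) (by simp)]
    norm_num
  exact le_antisymm (ge_of_tendsto' ht hle2) bot_le

lemma aux_approx_le {X : Type*} [MetricSpace X] {ι : Type*} [Countable ι] (f : ℝ → ℝ) (hf : f 0 = 0)
    (δ : ℝ) (A : Set X) (C : ι → Set X) (hA : A ⊆ ⋃ i, C i)
    (hC : ∀ i, Metric.ediam (C i) ≤ ENNReal.ofReal δ) :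
    hausdorffApprox f δ A ≤ ∑' i, ENNReal.ofReal (f (Metric.ediam (C i)).toReal) := by
  have := Encodable.ofCountable ι
  rw [← tsum_iUnion_decode₂ (fun S : Set X => ENNReal.ofReal (f (Metric.ediam S).toReal))
    (by simp [hf]) C]
  unfold hausdorffApprox
  refine iInf_le_of_le _ (iInf_le_of_le ?_ (iInf_le_of_le ?_ le_rfl))
  · rw [Encodable.iUnion_decode₂]; exact hA
  · intro n
    refine Encodable.iUnion_decode₂_cases (C := fun S => Metric.ediam S ≤ ENNReal.ofReal δ) ?_ hC
    simp

set_option linter.unusedSectionVars false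
section
variable {V : ℕ → Type} [∀ n, Fintype (V n)] [∀ n, DecidableEq (V n)] [∀ n, Nonempty (V n)]
    {G : ∀ n, SimpleGraph (V n)}

lemma aux_first {x y : ∀ n, V n} (hxy : x ≠ y) :
    ∃ k, (∀ i, i < k → x i = y i) ∧ x k ≠ y k := by
  classical
  have : ∃ k, x k ≠ y k := by
    by_contra hc; push Not at hc; exact hxy (funext hc)
  exact ⟨Nat.find this, fun i hi => by simpa using Nat.find_min this hi, Nat.find_spec this⟩

lemma aux_dist_le [MetricSpace (∀ n, V n)]
    (hdist_adj : ∀ x y : ∀ n, V n, ∀ n : ℕ, (∀ k, k < n → x k = y k) → x n ≠ y n →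
      (G n).Adj (x n) (y n) → dist x y = (2 : ℝ) ^ (1 - (n : ℤ)))
    (hdist_nadj : ∀ x y : ∀ n, V n, ∀ n : ℕ, (∀ k, k < n → x k = y k) → x n ≠ y n →
      ¬ (G n).Adj (x n) (y n) → dist x y = (2 : ℝ) ^ (-(n : ℤ)))
    (x y : ∀ n, V n) (n : ℕ) :
    dist x y ≤ (2 : ℝ) ^ (-(n : ℤ)) ↔ (∀ i, i < n → x i = y i) ∧ ¬ (G n).Adj (x n) (y n) := by
  by_cases hxy : x = y
  · subst hxy; simp
  obtain ⟨k, hk1, hk2⟩ := aux_first hxy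
  constructor
  · intro hd
    have hkn : n ≤ k := by
      by_contra hc
      have h1 : (2 : ℝ) ^ (-(k : ℤ)) ≤ dist x y := by
        by_cases ha : (G k).Adj (x k) (y k)
        · rw [hdist_adj x y k hk1 hk2 ha]
          exact zpow_le_zpow_right₀ (by norm_num) (by omega)
        · rw [hdist_nadj x y k hk1 hk2 ha]
      have h2 : (2 : ℝ) ^ (-(n : ℤ)) < (2 : ℝ) ^ (-(k : ℤ)) :=
        zpow_lt_zpow_right₀ (by norm_num) (by omega)
      linarith
    refine ⟨fun i hi => hk1 i (by omega), fun ha => ?_⟩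
    rcases hkn.eq_or_lt with h | h
    · subst h
      rw [hdist_adj x y n hk1 hk2 ha] at hd
      have h2 : (2 : ℝ) ^ (-(n : ℤ)) < (2 : ℝ) ^ (1 - (n : ℤ)) :=
        zpow_lt_zpow_right₀ (by norm_num) (by omega)
      linarith
    · exact ha.ne (hk1 n h)
  · rintro ⟨h1, h2⟩
    have hkn : n ≤ k := by
      by_contra hc
      exact hk2 (h1 k (by omega))
    by_cases ha : (G k).Adj (x k) (y k)
    · rw [hdist_adj x y k hk1 hk2 ha]
      have : n ≠ k := by rintro rfl; exact h2 ha
      exact zpow_le_zpow_right₀ (by norm_num) (by omega)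
    · rw [hdist_nadj x y k hk1 hk2 ha]
      exact zpow_le_zpow_right₀ (by norm_num) (by omega)

lemma aux_dist_gap [MetricSpace (∀ n, V n)]
    (hdist_adj : ∀ x y : ∀ n, V n, ∀ n : ℕ, (∀ k, k < n → x k = y k) → x n ≠ y n →
      (G n).Adj (x n) (y n) → dist x y = (2 : ℝ) ^ (1 - (n : ℤ)))
    (hdist_nadj : ∀ x y : ∀ n, V n, ∀ n : ℕ, (∀ k, k < n → x k = y k) → x n ≠ y n →
      ¬ (G n).Adj (x n) (y n) → dist x y = (2 : ℝ) ^ (-(n : ℤ)))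
    (x y : ∀ n, V n) (n : ℕ) (hd : (2 : ℝ) ^ (-((n + 1 : ℕ) : ℤ)) < dist x y) :
    (2 : ℝ) ^ (-(n : ℤ)) ≤ dist x y := by
  have hxy : x ≠ y := by
    rintro rfl
    rw [dist_self] at hd
    have : (0 : ℝ) < (2 : ℝ) ^ (-((n + 1 : ℕ) : ℤ)) := by positivity
    linarith
  obtain ⟨k, hk1, hk2⟩ := aux_first hxy
  obtain ⟨z, hz⟩ : ∃ z : ℤ, dist x y = (2 : ℝ) ^ z := by
    by_cases ha : (G k).Adj (x k) (y k)
    · exact ⟨_, hdist_adj x y k hk1 hk2 ha⟩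
    · exact ⟨_, hdist_nadj x y k hk1 hk2 ha⟩
  rw [hz] at hd ⊢
  have := (zpow_lt_zpow_iff_right₀ (by norm_num : (1 : ℝ) < 2)).1 hd
  exact zpow_le_zpow_right₀ (by norm_num) (by push_cast at this; omega)

/-- product of the `M k`. -/
lemma aux_prod (M : ℕ → ℕ) (hM0 : M 0 = 1) (hMsucc : ∀ n, M (n + 1) = 2 * Fintype.card (V n))
    (n : ℕ) : ∏ k ∈ Finset.range (n + 1), M k =
      2 ^ n * Fintype.card (∀ i : Fin n, V i) := by
  rw [Finset.prod_range_succ', hM0, mul_one]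
  simp only [hMsucc]
  rw [Finset.prod_mul_distrib, Fintype.card_pi, Finset.prod_const, Finset.card_range,
    Finset.prod_range]

lemma aux_gauge_mono (M : ℕ → ℕ) (hM : ∀ n, 1 ≤ M n)
    (h : ℝ → ℝ) (hh0 : h 0 = 0)
    (hhval : ∀ n : ℕ,
      h ((2 : ℝ) ^ (-(n : ℤ))) = 1 / ∏ k ∈ Finset.range (n + 1), (M k : ℝ))
    (hlin : ∀ n : ℕ, ∀ t : ℝ, (2 : ℝ) ^ (-(n : ℤ) - 1) ≤ t → t ≤ (2 : ℝ) ^ (-(n : ℤ)) →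
      h t = h ((2 : ℝ) ^ (-(n : ℤ) - 1)) +
        (t - (2 : ℝ) ^ (-(n : ℤ) - 1)) *
          (h ((2 : ℝ) ^ (-(n : ℤ))) - h ((2 : ℝ) ^ (-(n : ℤ) - 1))) /
            ((2 : ℝ) ^ (-(n : ℤ)) - (2 : ℝ) ^ (-(n : ℤ) - 1)))
    (n : ℕ) (t : ℝ) (ht0 : 0 ≤ t) (ht : t ≤ (2 : ℝ) ^ (-(n : ℤ))) :
    h t ≤ h ((2 : ℝ) ^ (-(n : ℤ))) := by
  have hM' : ∀ k, (1 : ℝ) ≤ M k := fun k => by exact_mod_cast hM k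
  have hP : ∀ n, (1 : ℝ) ≤ ∏ k ∈ Finset.range (n + 1), (M k : ℝ) := by
    intro n
    exact_mod_cast Finset.one_le_prod' (fun i _ => hM i)
  have hstep : ∀ n : ℕ, h ((2 : ℝ) ^ (-((n + 1 : ℕ) : ℤ))) ≤ h ((2 : ℝ) ^ (-(n : ℤ))) := by
    intro n
    rw [hhval, hhval]
    apply one_div_le_one_div_of_le (by linarith [hP n])
    rw [Finset.prod_range_succ _ (n + 1)]
    exact le_mul_of_one_le_right (by linarith [hP n]) (hM' _)
  have hanti : Antitone (fun n : ℕ => h ((2 : ℝ) ^ (-(n : ℤ)))) := antitone_nat_of_succ_le hstep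
  rcases ht0.eq_or_lt with h0 | h0
  · rw [← h0, hh0, hhval]
    have := hP n
    positivity
  have ht1 : t ≤ 1 := ht.trans (zpow_le_one_of_nonpos₀ (by norm_num) (by omega))
  obtain ⟨k, hk1, hk2⟩ := exists_nat_pow_near_of_lt_one h0 ht1
    (by norm_num : (0:ℝ) < 1/2) (by norm_num)
  have e : ∀ k : ℕ, (1 / 2 : ℝ) ^ k = (2 : ℝ) ^ (-(k : ℤ)) := by
    intro k; rw [zpow_neg, zpow_natCast, one_div, inv_pow]
  have e1 : (-(k : ℤ) - 1) = -((k + 1 : ℕ) : ℤ) := by push_cast; ring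
  rw [e] at hk1 hk2
  have hnk : n ≤ k := by
    by_contra hc
    have : (2 : ℝ) ^ (-(n : ℤ)) ≤ (2 : ℝ) ^ (-((k + 1 : ℕ) : ℤ)) :=
      zpow_le_zpow_right₀ (by norm_num) (by omega)
    linarith
  refine le_trans ?_ (hanti hnk)
  have := hlin k t (by rw [e1]; exact hk1.le) hk2
  rw [e1] at this
  rw [this]
  have hs := hstep k
  set A := h ((2 : ℝ) ^ (-(k : ℤ)))
  set B := h ((2 : ℝ) ^ (-((k + 1 : ℕ) : ℤ)))
  have hpos : 0 < (2 : ℝ) ^ (-(k : ℤ)) - (2 : ℝ) ^ (-((k + 1 : ℕ) : ℤ)) := by linarith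
  have : (t - (2 : ℝ) ^ (-((k + 1 : ℕ) : ℤ))) * (A - B) /
     ((2 : ℝ) ^ (-(k : ℤ)) - (2 : ℝ) ^ (-((k + 1 : ℕ) : ℤ))) ≤ A - B := by
    rw [div_le_iff₀ hpos, mul_comm]
    apply mul_le_mul_of_nonneg_left <;> linarith
  show _ ≤ A
  linarith

lemma aux_phi_null [MetricSpace (∀ n, V n)] (M : ℕ → ℕ)
    (hM0 : M 0 = 1) (hMsucc : ∀ n, M (n + 1) = 2 * Fintype.card (V n))
    (hdist_adj : ∀ x y : ∀ n, V n, ∀ n : ℕ, (∀ k, k < n → x k = y k) → x n ≠ y n →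
      (G n).Adj (x n) (y n) → dist x y = (2 : ℝ) ^ (1 - (n : ℤ)))
    (hdist_nadj : ∀ x y : ∀ n, V n, ∀ n : ℕ, (∀ k, k < n → x k = y k) → x n ≠ y n →
      ¬ (G n).Adj (x n) (y n) → dist x y = (2 : ℝ) ^ (-(n : ℤ)))
    (h : ℝ → ℝ) (hh0 : h 0 = 0)
    (hhval : ∀ n : ℕ,
      h ((2 : ℝ) ^ (-(n : ℤ))) = 1 / ∏ k ∈ Finset.range (n + 1), (M k : ℝ))
    (hmono : ∀ (n : ℕ) (t : ℝ), 0 ≤ t → t ≤ (2 : ℝ) ^ (-(n : ℤ)) → h t ≤ h ((2 : ℝ) ^ (-(n : ℤ))))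
    (K : ∀ n, Finset (V n)) (hK : ∀ n, IsIndepSet (G n) (K n : Set (V n))) :
    hausdorffGauge h {y : ∀ n, V n | ∀ m, ∃ n ≥ m, y n ∈ K n} = 0 := by
  unfold hausdorffGauge
  simp only [ENNReal.iSup_eq_zero]
  intro δ hδ
  have ht0 : Filter.Tendsto (fun j : ℕ => (2 : ℝ≥0∞)⁻¹ ^ j * 2) Filter.atTop (nhds (0 * 2)) :=
    ENNReal.Tendsto.mul_const
      (ENNReal.tendsto_pow_atTop_nhds_zero_of_lt_one (by simp)) (by simp)
  rw [zero_mul] at ht0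
  refine le_antisymm (ge_of_tendsto ht0 ?_) bot_le
  have hδ' : ∀ᶠ n : ℕ in Filter.atTop, (1 / 2 : ℝ) ^ n < δ :=
    (_root_.tendsto_pow_atTop_nhds_zero_of_lt_one (by norm_num) (by norm_num)).eventually_lt_const hδ
  obtain ⟨N, hN⟩ := Filter.eventually_atTop.1 hδ'
  filter_upwards [Filter.eventually_ge_atTop N] with m hm
  let C : (Σ n : ℕ, (∀ i : Fin (m + n), V i)) → Set (∀ n, V n) := fun p =>
    {y | (∀ i : Fin (m + p.1), y i = p.2 i) ∧ y (m + p.1) ∈ K (m + p.1)}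
  have hdiam : ∀ p, Metric.ediam (C p) ≤ ENNReal.ofReal ((2 : ℝ) ^ (-((m + p.1 : ℕ) : ℤ))) := by
    intro p
    refine Metric.ediam_le (fun x hx y hy => ?_)
    rw [edist_dist]
    apply ENNReal.ofReal_le_ofReal
    rw [aux_dist_le hdist_adj hdist_nadj]
    refine ⟨fun i hi => ?_, hK _ _ hx.2 _ hy.2⟩
    rw [hx.1 ⟨i, hi⟩, hy.1 ⟨i, hi⟩]
  refine (aux_approx_le h hh0 δ _ C ?_ ?_).trans ?_
  · intro y hy
    obtain ⟨n, hn, hyn⟩ := hy m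
    obtain ⟨d, rfl⟩ := Nat.exists_eq_add_of_le hn
    exact Set.mem_iUnion.2 ⟨⟨d, fun i => y i⟩, fun i => rfl, hyn⟩
  · intro p
    refine (hdiam p).trans (ENNReal.ofReal_le_ofReal ?_)
    have := hN (m + p.1) (by omega)
    rw [one_div, inv_pow] at this
    rw [zpow_neg, zpow_natCast]
    exact this.le
  have hcost : ∀ p, ENNReal.ofReal (h (Metric.ediam (C p)).toReal) ≤
      (2 : ℝ≥0∞)⁻¹ ^ (m + p.1) * (Fintype.card (∀ i : Fin (m + p.1), V i) : ℝ≥0∞)⁻¹ := by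
    intro p
    have h1 := hmono (m + p.1) (Metric.ediam (C p)).toReal ENNReal.toReal_nonneg (by
      have := ENNReal.toReal_mono ENNReal.ofReal_ne_top (hdiam p)
      rwa [ENNReal.toReal_ofReal (by positivity)] at this)
    refine (ENNReal.ofReal_le_ofReal h1).trans (le_of_eq ?_)
    rw [hhval]
    have h2 := aux_prod M hM0 hMsucc (m + p.1)
    have h3 : ∏ k ∈ Finset.range (m + p.1 + 1), (M k : ℝ) =
      2 ^ (m + p.1) * (Fintype.card (∀ i : Fin (m + p.1), V i) : ℝ) := by exact_mod_cast h2
    have hc : 0 < (Fintype.card (∀ i : Fin (m + p.1), V i) : ℝ) := by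
      exact_mod_cast Fintype.card_pos
    rw [h3, one_div, ENNReal.ofReal_inv_of_pos (by positivity), ENNReal.ofReal_mul (by positivity),
      ENNReal.mul_inv (by left; simp) (by left; simp), ENNReal.ofReal_natCast,
      ENNReal.ofReal_pow (by norm_num), ENNReal.inv_pow]
    simp
  refine (ENNReal.tsum_le_tsum hcost).trans ?_
  rw [ENNReal.tsum_sigma']
  have : ∀ n : ℕ, ∑' s : (∀ i : Fin (m + n), V i), (2 : ℝ≥0∞)⁻¹ ^ (m + n) *
      (Fintype.card (∀ i : Fin (m + n), V i) : ℝ≥0∞)⁻¹ = 2⁻¹ ^ m * 2⁻¹ ^ n := by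
    intro n
    rw [tsum_fintype, Finset.sum_const, nsmul_eq_mul, Finset.card_univ, mul_left_comm,
      ENNReal.mul_inv_cancel (by exact_mod_cast Fintype.card_ne_zero)
      (ENNReal.natCast_ne_top _), mul_one, pow_add]
  simp only [this]
  rw [ENNReal.tsum_mul_left, ENNReal.tsum_geometric, ENNReal.one_sub_inv_two, inv_inv]
end

section
variable {V : ℕ → Type} [∀ n, Fintype (V n)] [∀ n, DecidableEq (V n)] [∀ n, Nonempty (V n)]
    {G : ∀ n, SimpleGraph (V n)}

open Classical in
/-- remaining budget below the node `y` restricted to `n`. -/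
noncomputable def auxBud (M : ℕ → ℕ) (lv : ℕ → ℕ) (b : ℕ → ∀ n, V n) (y : ∀ n, V n) (n : ℕ)
    (j : ℕ) : ℝ≥0∞ :=
  if n ≤ lv j ∧ ∀ i, i < n → b j i = y i then
    (∏ k ∈ Finset.range (lv j + 1), (M k : ℝ≥0∞))⁻¹ else 0

lemma aux_step (M : ℕ → ℕ) (hM : ∀ n, 1 ≤ M n)
    (hpart : ∀ n, ¬ ∃ p : V n → Fin (M n), ∀ i : Fin (M n), IsIndepSet (G n) {v | p v = i})
    (lv : ℕ → ℕ) (b : ℕ → ∀ n, V n) (H : ∀ j, Set (V (lv j)))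
    (hH : ∀ j, IsIndepSet (G (lv j)) (H j)) (y : ∀ n, V n) (n : ℕ)
    (hy : ∑' j, auxBud M lv b y n j < (∏ k ∈ Finset.range n, (M k : ℝ≥0∞))⁻¹) :
    ∃ y' : ∀ n, V n, (∀ i, i < n → y' i = y i) ∧
      ∑' j, auxBud M lv b y' (n + 1) j < (∏ k ∈ Finset.range (n + 1), (M k : ℝ≥0∞))⁻¹ ∧
      ∀ j, lv j = n → (∀ i, i < n → b j i = y i) → y' (lv j) ∉ H j := by
  classical
  by_contra hcon
  push Not at hcon
  set c := (∏ k ∈ Finset.range (n + 1), (M k : ℝ≥0∞))⁻¹ with hc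
  let up : V n → ∀ i, V i := fun a => Function.update y n a
  have hup : ∀ a i, i < n → up a i = y i := fun a i hi => by
    simp only [up]; rw [Function.update_of_ne (by omega)]
  have hupn : ∀ a, up a n = a := fun a => by simp [up]
  let cov : V n → ℕ → Prop := fun a j =>
    lv j = n ∧ (∀ i, i < n → b j i = y i) ∧ up a (lv j) ∈ H j
  have hdich : ∀ a, (¬ ∃ j, cov a j) → c ≤ ∑' j, auxBud M lv b (up a) (n + 1) j := by
    intro a ha
    by_contra hlt
    push Not at hlt
    obtain ⟨j, h1, h2, h3⟩ := hcon (up a) (hup a) hlt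
    exact ha ⟨j, h1, h2, h3⟩
  let p : V n → ℕ ⊕ V n := fun a => if h : ∃ j, cov a j then Sum.inl h.choose else Sum.inr a
  have hp1 : ∀ a j, p a = Sum.inl j → cov a j := by
    intro a j hj
    simp only [p] at hj
    split_ifs at hj with h
    · have := h.choose_spec
      rwa [Sum.inl.inj hj] at this
  have hp2 : ∀ a v, p a = Sum.inr v → a = v ∧ ¬ ∃ j, cov a j := by
    intro a v hj
    simp only [p] at hj
    split_ifs at hj with h
    exact ⟨Sum.inr.inj hj, h⟩
  let J : Finset ℕ := (Finset.univ.image p).toLeft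
  let U : Finset (V n) := (Finset.univ.image p).toRight
  have hJ : ∀ j ∈ J, lv j = n ∧ ∀ i, i < n → b j i = y i := by
    intro j hj
    simp only [J, Finset.mem_toLeft, Finset.mem_image, Finset.mem_univ, true_and] at hj
    obtain ⟨a, ha⟩ := hj
    exact ⟨(hp1 a j ha).1, (hp1 a j ha).2.1⟩
  have hU : ∀ v ∈ U, c ≤ ∑' j, auxBud M lv b (up v) (n + 1) j := by
    intro v hv
    simp only [U, Finset.mem_toRight, Finset.mem_image, Finset.mem_univ, true_and] at hv
    obtain ⟨a, ha⟩ := hv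
    obtain ⟨rfl, h⟩ := hp2 a v ha
    exact hdich a h
  have hcard : (Finset.univ.image p).card = J.card + U.card :=
    (Finset.card_toLeft_add_card_toRight).symm
  -- the budget inequality
  have hterm : ∀ j, (if j ∈ J then c else 0) + ∑ v ∈ U, auxBud M lv b (up v) (n + 1) j ≤
      auxBud M lv b y n j := by
    intro j
    by_cases hj : j ∈ J
    · obtain ⟨h1, h2⟩ := hJ j hj
      have h0 : ∀ v ∈ U, auxBud M lv b (up v) (n + 1) j = 0 := by
        intro v _
        unfold auxBud
        rw [if_neg]
        rintro ⟨h, -⟩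
        omega
      rw [Finset.sum_eq_zero h0, add_zero, if_pos hj]
      unfold auxBud
      rw [if_pos ⟨h1.ge, h2⟩, h1]
    · rw [if_neg hj, zero_add]
      by_cases hq : n + 1 ≤ lv j ∧ ∀ i, i < n → b j i = y i
      · have h0 : ∀ v ∈ U, v ≠ b j n → auxBud M lv b (up v) (n + 1) j = 0 := by
          intro v _ hv
          unfold auxBud
          rw [if_neg]
          rintro ⟨-, h⟩
          have := h n (by omega)
          rw [hupn] at this
          exact hv this.symm
        refine (Finset.sum_le_sum_of_ne_zero (t := {b j n}) ?_).trans ?_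
        · intro v hv hne
          by_contra hh
          exact hne (h0 v hv (by simpa using hh))
        · rw [Finset.sum_singleton]
          unfold auxBud
          rw [if_pos (show n ≤ lv j ∧ _ from ⟨by omega, hq.2⟩)]
          split_ifs
          · exact le_rfl
          · exact bot_le
      · rw [Finset.sum_eq_zero]
        · exact bot_le
        · intro v _
          unfold auxBud
          rw [if_neg]
          rintro ⟨h1, h2⟩
          refine hq ⟨h1, fun i hi => ?_⟩
          rw [h2 i (by omega), hup v i hi]
  have hsum : ((J.card + U.card : ℕ) : ℝ≥0∞) * c ≤ ∑' j, auxBud M lv b y n j := by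
    calc ((J.card + U.card : ℕ) : ℝ≥0∞) * c = J.card * c + U.card * c := by push_cast; ring
      _ ≤ (∑' j, if j ∈ J then c else 0) + ∑ v ∈ U, ∑' j, auxBud M lv b (up v) (n + 1) j := by
          apply add_le_add
          · rw [tsum_eq_sum (s := J) (fun j hj => if_neg hj)]
            rw [Finset.sum_congr rfl (fun j hj => if_pos hj), Finset.sum_const, nsmul_eq_mul]
          · have := Finset.sum_le_sum hU
            rwa [Finset.sum_const, nsmul_eq_mul] at this
      _ = ∑' j, ((if j ∈ J then c else 0) + ∑ v ∈ U, auxBud M lv b (up v) (n + 1) j) := by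
          rw [ENNReal.tsum_add, Summable.tsum_finsetSum (fun _ _ => ENNReal.summable)]
      _ ≤ _ := ENNReal.tsum_le_tsum hterm
  have hlt := hsum.trans_lt hy
  have hP : (∏ k ∈ Finset.range n, (M k : ℝ≥0∞)) ≠ 0 := by
    rw [Finset.prod_ne_zero_iff]
    intro k _
    have := hM k
    exact_mod_cast (by omega : M k ≠ 0)
  have hP2 : (∏ k ∈ Finset.range n, (M k : ℝ≥0∞)) ≠ ⊤ :=
    ENNReal.prod_ne_top (fun k _ => ENNReal.natCast_ne_top _)
  have hMn : (M n : ℝ≥0∞) ≠ 0 := by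
    have := hM n
    exact_mod_cast (by omega : M n ≠ 0)
  have hle : J.card + U.card ≤ M n := by
    by_contra hgt
    push Not at hgt
    apply absurd hlt
    push Not
    calc (∏ k ∈ Finset.range n, (M k : ℝ≥0∞))⁻¹ = (M n : ℝ≥0∞) * c := by
          rw [hc, Finset.prod_range_succ, ENNReal.mul_inv (Or.inl hP) (Or.inl hP2), mul_left_comm,
            ENNReal.mul_inv_cancel hMn (ENNReal.natCast_ne_top _), mul_one]
      _ ≤ _ := by
          gcongr
  -- the colouring
  apply hpart n
  let e := (Finset.univ.image p).equivFin
  have hmem : ∀ a, p a ∈ Finset.univ.image p := fun a =>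
    Finset.mem_image_of_mem _ (Finset.mem_univ a)
  refine ⟨fun a => Fin.castLE (hcard.le.trans hle) (e ⟨p a, hmem a⟩), ?_⟩
  intro i u hu v hv hadj
  have huv : p u = p v := by
    have h1 : Fin.castLE (hcard.le.trans hle) (e ⟨p u, hmem u⟩) =
      Fin.castLE (hcard.le.trans hle) (e ⟨p v, hmem v⟩) := hu.trans hv.symm
    have h2 := e.injective (Fin.castLE_injective _ h1)
    exact congrArg Subtype.val h2
  rcases hpu : p u with j | w
  · obtain ⟨h1, -, h3⟩ := hp1 u j hpu
    obtain ⟨-, -, h4⟩ := hp1 v j (huv ▸ hpu)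
    have := hH j _ h3 _ h4
    subst h1
    rw [hupn, hupn] at this
    exact this hadj
  · have h1 := (hp2 u w hpu).1
    have h2 := (hp2 v w (huv ▸ hpu)).1
    exact hadj.ne (h1.trans h2.symm)

lemma aux_branch (M : ℕ → ℕ) (hM : ∀ n, 1 ≤ M n)
    (hpart : ∀ n, ¬ ∃ p : V n → Fin (M n), ∀ i : Fin (M n), IsIndepSet (G n) {v | p v = i})
    (lv : ℕ → ℕ) (b : ℕ → ∀ n, V n) (H : ∀ j, Set (V (lv j)))
    (hH : ∀ j, IsIndepSet (G (lv j)) (H j))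
    (hsum : ∑' j, (∏ k ∈ Finset.range (lv j + 1), (M k : ℝ≥0∞))⁻¹ < 1) :
    ∃ z : ∀ n, V n, ∀ j, ¬ ((∀ i, i < lv j → b j i = z i) ∧ z (lv j) ∈ H j) := by
  classical
  let T := {q : ℕ × (∀ n, V n) //
    ∑' j, auxBud M lv b q.2 q.1 j < (∏ k ∈ Finset.range q.1, (M k : ℝ≥0∞))⁻¹}
  have step := fun (q : T) => aux_step (G := G) M hM hpart lv b H hH q.1.2 q.1.1 q.2
  choose nx hn1 hn2 hn3 using step
  have y0 : ∀ n, V n := fun n => Classical.arbitrary _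
  let q0 : T := ⟨(0, y0), by
    simp only [Finset.range_zero, Finset.prod_empty, inv_one]
    refine lt_of_le_of_lt (ENNReal.tsum_le_tsum fun j => ?_) hsum
    unfold auxBud
    rw [if_pos]
    exact ⟨Nat.zero_le _, fun i hi => absurd hi (Nat.not_lt_zero _)⟩⟩
  let S : T → T := fun q => ⟨(q.1.1 + 1, nx q), hn2 q⟩
  let Q : ℕ → T := fun n => S^[n] q0
  have hQs : ∀ n, Q (n + 1) = S (Q n) := fun n => Function.iterate_succ_apply' S n q0
  have hQ1 : ∀ n, (Q n).1.1 = n := by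
    intro n
    induction n with
    | zero => rfl
    | succ n ih => rw [hQs]; simp only [S]; rw [ih]
  have hQ2 : ∀ n i, i < n → (Q (n + 1)).1.2 i = (Q n).1.2 i := by
    intro n i hi
    rw [hQs]
    exact hn1 (Q n) i (by rw [hQ1]; exact hi)
  have hQ3 : ∀ i d, (Q (i + 1 + d)).1.2 i = (Q (i + 1)).1.2 i := by
    intro i d
    induction d with
    | zero => rfl
    | succ d ih => rw [← ih, ← add_assoc]; exact hQ2 _ i (by omega)
  refine ⟨fun i => (Q (i + 1)).1.2 i, ?_⟩
  rintro j ⟨h1, h2⟩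
  beta_reduce at h1 h2
  refine hn3 (Q (lv j)) j (hQ1 _).symm ?_ ?_
  · rw [hQ1]
    intro i hi
    obtain ⟨d, hd⟩ := Nat.exists_eq_add_of_le (show i + 1 ≤ lv j by omega)
    rw [h1 i hi, ← hQ3 i d, ← hd]
  · rw [hQs] at h2
    exact h2
end

section
variable {V : ℕ → Type} [∀ n, Fintype (V n)] [∀ n, DecidableEq (V n)] [∀ n, Nonempty (V n)]
    {G : ∀ n, SimpleGraph (V n)}

lemma aux_level [MetricSpace (∀ n, V n)] (M : ℕ → ℕ)
    (hM0 : M 0 = 1) (hMsucc : ∀ n, M (n + 1) = 2 * Fintype.card (V n))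
    (hdist_adj : ∀ x y : ∀ n, V n, ∀ n : ℕ, (∀ k, k < n → x k = y k) → x n ≠ y n →
      (G n).Adj (x n) (y n) → dist x y = (2 : ℝ) ^ (1 - (n : ℤ)))
    (hdist_nadj : ∀ x y : ∀ n, V n, ∀ n : ℕ, (∀ k, k < n → x k = y k) → x n ≠ y n →
      ¬ (G n).Adj (x n) (y n) → dist x y = (2 : ℝ) ^ (-(n : ℤ)))
    (h : ℝ → ℝ)
    (hhval : ∀ n : ℕ,
      h ((2 : ℝ) ^ (-(n : ℤ))) = 1 / ∏ k ∈ Finset.range (n + 1), (M k : ℝ))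
    (C : Set (∀ n, V n)) (hC : Metric.ediam C ≤ ENNReal.ofReal 1) (e : ℕ) :
    ∃ (n : ℕ) (x : ∀ n, V n) (H : Set (V n)), IsIndepSet (G n) H ∧
      (∀ y ∈ C, (∀ i, i < n → x i = y i) ∧ y n ∈ H) ∧
      (∏ k ∈ Finset.range (n + 1), (M k : ℝ≥0∞))⁻¹ ≤
        ENNReal.ofReal (h (Metric.ediam C).toReal) + 2⁻¹ ^ e := by
  classical
  rcases C.eq_empty_or_nonempty with hne | ⟨x, hx⟩
  · refine ⟨e, fun n => Classical.arbitrary _, ∅, fun x hx => absurd hx (by simp), ?_, ?_⟩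
    · intro y hy; rw [hne] at hy; exact absurd hy (by simp)
    · refine le_trans ?_ le_add_self
      have h2 := aux_prod M hM0 hMsucc e
      have h3 : ∏ k ∈ Finset.range (e + 1), (M k : ℝ≥0∞) =
        2 ^ e * (Fintype.card (∀ i : Fin e, V i) : ℝ≥0∞) := by exact_mod_cast h2
      rw [h3, ← ENNReal.inv_pow, ENNReal.inv_le_inv]
      refine le_mul_of_one_le_right bot_le ?_
      exact_mod_cast Fintype.card_pos
  have hlev : ∀ n : ℕ, (∀ y ∈ C, ∀ z ∈ C, dist y z ≤ (2 : ℝ) ^ (-(n : ℤ))) →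
      ∃ (H : Set (V n)), IsIndepSet (G n) H ∧ (∀ y ∈ C, (∀ i, i < n → x i = y i) ∧ y n ∈ H) := by
    intro n hn
    refine ⟨(fun y => y n) '' C, ?_, fun y hy => ⟨?_, y, hy, rfl⟩⟩
    · rintro _ ⟨y, hy, rfl⟩ _ ⟨z, hz, rfl⟩
      exact ((aux_dist_le hdist_adj hdist_nadj y z n).1 (hn y hy z hz)).2
    · exact ((aux_dist_le hdist_adj hdist_nadj x y n).1 (hn x hx y hy)).1
  by_cases hall : ∀ n : ℕ, ∀ y ∈ C, ∀ z ∈ C, dist y z ≤ (2 : ℝ) ^ (-(n : ℤ))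
  · obtain ⟨H, h1, h2⟩ := hlev e (hall e)
    refine ⟨e, x, H, h1, h2, ?_⟩
    refine le_trans ?_ le_add_self
    have h2 := aux_prod M hM0 hMsucc e
    have h3 : ∏ k ∈ Finset.range (e + 1), (M k : ℝ≥0∞) =
        2 ^ e * (Fintype.card (∀ i : Fin e, V i) : ℝ≥0∞) := by exact_mod_cast h2
    rw [h3, ← ENNReal.inv_pow, ENNReal.inv_le_inv]
    refine le_mul_of_one_le_right bot_le ?_
    exact_mod_cast Fintype.card_pos
  · push Not at hall
    have h0 : ∀ y ∈ C, ∀ z ∈ C, dist y z ≤ (2 : ℝ) ^ (-((0 : ℕ) : ℤ)) := by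
      intro y hy z hz
      have := (Metric.edist_le_ediam_of_mem hy hz).trans hC
      rw [edist_dist, ENNReal.ofReal_le_ofReal_iff (by norm_num)] at this
      simpa using this
    obtain ⟨n, hn, hn'⟩ : ∃ n : ℕ, (∀ y ∈ C, ∀ z ∈ C, dist y z ≤ (2 : ℝ) ^ (-(n : ℤ))) ∧
        ¬ (∀ y ∈ C, ∀ z ∈ C, dist y z ≤ (2 : ℝ) ^ (-((n + 1 : ℕ) : ℤ))) := by
      by_contra hcon
      push Not at hcon
      obtain ⟨n, y, hy, z, hz, hlt⟩ := hall
      have : ∀ n : ℕ, (∀ y ∈ C, ∀ z ∈ C, dist y z ≤ (2 : ℝ) ^ (-(n : ℤ))) := by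
        intro n
        induction n with
        | zero => exact h0
        | succ n ih => exact hcon n ih
      exact absurd (this n y hy z hz) (not_le.2 hlt)
    obtain ⟨H, h1, h2⟩ := hlev n hn
    refine ⟨n, x, H, h1, h2, ?_⟩
    push Not at hn'
    obtain ⟨y, hy, z, hz, hlt⟩ := hn'
    have hge := aux_dist_gap hdist_adj hdist_nadj y z n hlt
    have hd : Metric.ediam C = ENNReal.ofReal ((2 : ℝ) ^ (-(n : ℤ))) := by
      apply le_antisymm
      · refine Metric.ediam_le (fun y hy z hz => ?_)
        rw [edist_dist]
        exact ENNReal.ofReal_le_ofReal (hn y hy z hz)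
      · refine le_trans ?_ (Metric.edist_le_ediam_of_mem hy hz)
        rw [edist_dist]
        exact ENNReal.ofReal_le_ofReal hge
    rw [hd, ENNReal.toReal_ofReal (by positivity), hhval]
    refine le_trans (le_of_eq ?_) le_self_add
    have h2 := aux_prod M hM0 hMsucc n
    have hpos : 0 < ∏ k ∈ Finset.range (n + 1), M k := by
      rw [h2]; exact Nat.mul_pos (by positivity) Fintype.card_pos
    have h3 : ∏ k ∈ Finset.range (n + 1), (M k : ℝ) = ((∏ k ∈ Finset.range (n + 1), M k : ℕ) : ℝ) :=
      by push_cast; rfl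
    have h4 : ∏ k ∈ Finset.range (n + 1), (M k : ℝ≥0∞) =
      ((∏ k ∈ Finset.range (n + 1), M k : ℕ) : ℝ≥0∞) := by push_cast; rfl
    rw [h3, h4, one_div, ENNReal.ofReal_inv_of_pos (by exact_mod_cast hpos), ENNReal.ofReal_natCast]

lemma aux_pos [MetricSpace (∀ n, V n)] (M : ℕ → ℕ)
    (hM0 : M 0 = 1) (hMsucc : ∀ n, M (n + 1) = 2 * Fintype.card (V n)) (hM : ∀ n, 1 ≤ M n)
    (hpart : ∀ n, ¬ ∃ p : V n → Fin (M n), ∀ i : Fin (M n), IsIndepSet (G n) {v | p v = i})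
    (hdist_adj : ∀ x y : ∀ n, V n, ∀ n : ℕ, (∀ k, k < n → x k = y k) → x n ≠ y n →
      (G n).Adj (x n) (y n) → dist x y = (2 : ℝ) ^ (1 - (n : ℤ)))
    (hdist_nadj : ∀ x y : ∀ n, V n, ∀ n : ℕ, (∀ k, k < n → x k = y k) → x n ≠ y n →
      ¬ (G n).Adj (x n) (y n) → dist x y = (2 : ℝ) ^ (-(n : ℤ)))
    (h : ℝ → ℝ)
    (hhval : ∀ n : ℕ,
      h ((2 : ℝ) ^ (-(n : ℤ))) = 1 / ∏ k ∈ Finset.range (n + 1), (M k : ℝ)) :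
    hausdorffGauge h (Set.univ : Set (∀ n, V n)) ≠ 0 := by
  intro hz
  have h1 : hausdorffApprox h 1 (Set.univ : Set (∀ n, V n)) < 2⁻¹ := by
    have : hausdorffApprox h 1 (Set.univ : Set (∀ n, V n)) ≤ 0 := by
      rw [← hz]
      exact le_iSup₂_of_le (1 : ℝ) one_pos le_rfl
    exact this.trans_lt (by simp)
  unfold hausdorffApprox at h1
  simp only [iInf_lt_iff] at h1
  obtain ⟨C, hC1, hC2, hC3⟩ := h1
  choose lv b H hH hCH hcost using fun j => aux_level (G := G) M hM0 hMsucc hdist_adj hdist_nadj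
    h hhval (C j) (hC2 j) (j + 2)
  obtain ⟨z, hz⟩ := aux_branch (G := G) M hM hpart lv b H hH (by
    refine lt_of_le_of_lt (ENNReal.tsum_le_tsum hcost) ?_
    rw [ENNReal.tsum_add]
    have h2 : ∑' j : ℕ, (2⁻¹ : ℝ≥0∞) ^ (j + 2) = 2⁻¹ := by
      have : ∀ j : ℕ, (2⁻¹ : ℝ≥0∞) ^ (j + 2) = 2⁻¹ ^ 2 * 2⁻¹ ^ j := fun j => by ring
      rw [tsum_congr this]
      rw [ENNReal.tsum_mul_left, ENNReal.tsum_geometric, ENNReal.one_sub_inv_two, pow_two,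
        mul_assoc, ENNReal.mul_inv_cancel (by simp) (by simp), mul_one]
    rw [h2, ← ENNReal.inv_two_add_inv_two]
    exact ENNReal.add_lt_add_right (by simp) hC3)
  obtain ⟨j, hj⟩ := Set.mem_iUnion.1 (hC1 (Set.mem_univ z))
  exact hz j (hCH j z hj)

end

lemma aux_tukey {α β : Type} (I : Set (Set α)) (J : Set (Set β)) (φ : β → Set α) (hφ : ∀ x, φ x ∈ I)
    (hψ : ∀ y : α, {x | y ∉ φ x} ∈ J) (hdown : ∀ A ∈ J, ∀ B ⊆ A, B ∈ J)
    (hne : Set.univ ∉ J) : covIdeal I ≤ nonIdeal J := by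
  unfold covIdeal nonIdeal
  refine le_csInf ⟨_, Set.univ, hne, rfl⟩ ?_
  rintro c ⟨A, hA, rfl⟩
  refine le_trans (csInf_le' ⟨φ '' A, ?_, ?_, rfl⟩) Cardinal.mk_image_le
  · rintro _ ⟨x, -, rfl⟩; exact hφ x
  · ext y
    simp only [Set.mem_sUnion, Set.mem_univ, iff_true]
    by_contra hc
    refine hA (hdown _ (hψ y) A (fun x hx hy => hc ⟨φ x, ⟨x, hx, rfl⟩, hy⟩))

lemma aux_gauge_down {X : Type*} [MetricSpace X] (f : ℝ → ℝ) (A : Set X)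
    (hA : hausdorffGauge f A = 0) (B : Set X) (hB : B ⊆ A) : hausdorffGauge f B = 0 := by
  refine le_antisymm (le_trans ?_ hA.le) bot_le
  refine iSup₂_mono (fun δ _ => ?_)
  unfold hausdorffApprox
  refine iInf_mono (fun C => ?_)
  exact iInf_mono' (fun h => ⟨hB.trans h, le_rfl⟩)


/-- With the Davies–Rogers construction data (graphs satisfying (i), (ii),
(iii)), let `N^h_Ω` be the ideal of `h`-Hausdorff null subsets of `Ω`, and `E` the σ-ideal on
Cantor space generated by closed sets null for the uniform coin-flipping product measure `μ`
(characterized by its values on cylinders). Then `cov(N^h_Ω) ≤ non(E)` and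
`cov(E) ≤ non(N^h_Ω)`. -/
theorem statement12
    (V : ℕ → Type) [∀ n, Fintype (V n)] [∀ n, DecidableEq (V n)] [∀ n, Nonempty (V n)]
    (G : ∀ n, SimpleGraph (V n))
    (M : ℕ → ℕ) (hM0 : M 0 = 1) (hMsucc : ∀ n, M (n + 1) = 2 * Fintype.card (V n))
    -- (i): the vertex set of `G n` cannot be partitioned into `M n` independent sets
    (hpart : ∀ n, ¬ ∃ p : V n → Fin (M n), ∀ i : Fin (M n), IsIndepSet (G n) {v | p v = i})
    -- (ii): the weighted independent-set property
    (hweight : ∀ n, ∀ w : V n → ℝ, (∀ v, 0 ≤ w v) →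
      ∃ H : Finset (V n), IsIndepSet (G n) ↑H ∧
        (1 / 4 : ℝ) * ∑ g : V n, w g ≤ ∑ g ∈ H, w g)
    -- (iii): a family of independent sets `H n x ∋ x` such that every vertex `a` belongs
    -- to `H n x` for at least a quarter of the vertices `x`
    (hfam : ∀ n, ∃ Hf : V n → Finset (V n),
      (∀ x, IsIndepSet (G n) ↑(Hf x) ∧ x ∈ Hf x) ∧
      ∀ a : V n, (Fintype.card (V n) : ℝ) / 4 ≤
        ((Finset.univ.filter fun x => a ∈ Hf x).card : ℝ))
    -- the metric ρ on Ω
    [MetricSpace (∀ n, V n)]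
    (hdist_adj : ∀ x y : ∀ n, V n, ∀ n : ℕ, (∀ k, k < n → x k = y k) → x n ≠ y n →
      (G n).Adj (x n) (y n) → dist x y = (2 : ℝ) ^ (1 - (n : ℤ)))
    (hdist_nadj : ∀ x y : ∀ n, V n, ∀ n : ℕ, (∀ k, k < n → x k = y k) → x n ≠ y n →
      ¬ (G n).Adj (x n) (y n) → dist x y = (2 : ℝ) ^ (-(n : ℤ)))
    -- the gauge function h
    (h : ℝ → ℝ) (hh0 : h 0 = 0)
    (hhval : ∀ n : ℕ,
      h ((2 : ℝ) ^ (-(n : ℤ))) = 1 / ∏ k ∈ Finset.range (n + 1), (M k : ℝ))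
    (hlin : ∀ n : ℕ, ∀ t : ℝ, (2 : ℝ) ^ (-(n : ℤ) - 1) ≤ t → t ≤ (2 : ℝ) ^ (-(n : ℤ)) →
      h t = h ((2 : ℝ) ^ (-(n : ℤ) - 1)) +
        (t - (2 : ℝ) ^ (-(n : ℤ) - 1)) *
          (h ((2 : ℝ) ^ (-(n : ℤ))) - h ((2 : ℝ) ^ (-(n : ℤ) - 1))) /
            ((2 : ℝ) ^ (-(n : ℤ)) - (2 : ℝ) ^ (-(n : ℤ) - 1)))
    (hone : ∀ t : ℝ, 1 ≤ t → h t = 1)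
    -- the uniform coin-flipping product probability measure on Cantor space
    (μ : MeasureTheory.Measure (ℕ → Bool))
    (hμ : ∀ (s : Finset ℕ) (y : ℕ → Bool),
      μ {x : ℕ → Bool | ∀ i ∈ s, x i = y i} = (1 / 2 : ℝ≥0∞) ^ s.card) :
    covIdeal {A : Set (∀ n, V n) | hausdorffGauge h A = 0} ≤ nonIdeal (closedNullIdeal μ) ∧
      covIdeal (closedNullIdeal μ) ≤
        nonIdeal {A : Set (∀ n, V n) | hausdorffGauge h A = 0} := by
  have hM : ∀ n, 1 ≤ M n := by
    intro n
    cases n with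
    | zero => rw [hM0]
    | succ n =>
      rw [hMsucc]
      have : 0 < Fintype.card (V n) := Fintype.card_pos
      omega
  have hmono := aux_gauge_mono M hM h hh0 hhval hlin
  choose Hf hHf1 hHf2 using hfam
  choose k f hf1 hf2 using fun n => aux_surj (V n)
  let a : ℕ → ℕ := fun n => ∑ i ∈ Finset.range n, k i
  have ha : ∀ n, a (n + 1) = a n + k n := fun n => Finset.sum_range_succ _ _
  let φ : (ℕ → Bool) → Set (∀ n, V n) := fun x =>
    {y | ∀ m, ∃ n ≥ m, y n ∈ Hf n (f n (fun i : Fin (k n) => x (a n + i)))}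
  have hφ : ∀ x, φ x ∈ {A : Set (∀ n, V n) | hausdorffGauge h A = 0} := by
    intro x
    exact aux_phi_null M hM0 hMsucc hdist_adj hdist_nadj h hh0 hhval hmono
      (fun n => Hf n (f n (fun i : Fin (k n) => x (a n + i)))) (fun n => (hHf1 n _).1)
  have hψ : ∀ y, {x | y ∉ φ x} ∈ closedNullIdeal μ := by
    intro y
    let B : ∀ n, Finset (Fin (k n) → Bool) := fun n =>
      Finset.univ.filter (fun t => y n ∉ Hf n (f n t))
    have hB : ∀ n, 8 * (B n).card ≤ 7 * 2 ^ (k n) := by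
      intro n
      have h1 := Finset.card_filter_add_card_filter_not
        (s := (Finset.univ : Finset (Fin (k n) → Bool))) (fun t => y n ∈ Hf n (f n t))
      have h2 : (Finset.univ.filter fun v => y n ∈ Hf n v).card ≤
          (Finset.univ.filter fun t => y n ∈ Hf n (f n t)).card := by
        refine Finset.card_le_card_of_surjOn (f n) ?_
        intro v hv
        obtain ⟨t, rfl⟩ := hf1 n v
        refine ⟨t, ?_, rfl⟩
        simpa using hv
      have h3 : Fintype.card (V n) ≤ 4 * (Finset.univ.filter fun v => y n ∈ Hf n v).card := by
        have := hHf2 n (y n)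
        rw [div_le_iff₀ (by norm_num)] at this
        have : (Fintype.card (V n) : ℝ) ≤
          4 * ((Finset.univ.filter fun v => y n ∈ Hf n v).card : ℝ) := by linarith
        exact_mod_cast this
      have h4 := hf2 n
      have h5 : (Finset.univ : Finset (Fin (k n) → Bool)).card = 2 ^ (k n) := by simp
      rw [h5] at h1
      simp only [B]
      omega
    refine ⟨fun m => {x : ℕ → Bool | ∀ n ≥ m, (fun i : Fin (k n) => x (a n + i)) ∈ B n},
      fun m => ⟨?_, aux_null μ hμ k a ha B hB m⟩, ?_⟩
    · simp only [Set.setOf_forall]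
      refine isClosed_iInter fun n => isClosed_iInter fun _ => ?_
      have hc : Continuous (fun (x : ℕ → Bool) (i : Fin (k n)) => x (a n + i)) := by fun_prop
      exact (isClosed_discrete (B n : Set (Fin (k n) → Bool))).preimage hc
    · intro x hx
      simp only [φ, Set.mem_setOf_eq] at hx
      push Not at hx
      obtain ⟨m, hm⟩ := hx
      refine Set.mem_iUnion.2 ⟨m, fun n hn => ?_⟩
      simp only [B, Finset.mem_filter, Finset.mem_univ, true_and]
      exact hm n hn
  constructor
  · refine aux_tukey _ _ φ hφ hψ ?_ ?_
    · rintro A ⟨C, hC, hA⟩ B hB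
      exact ⟨C, hC, hB.trans hA⟩
    · rintro ⟨C, hC, hA⟩
      have h1 : μ Set.univ ≤ 0 := by
        refine (MeasureTheory.measure_mono hA).trans ?_
        rw [MeasureTheory.measure_iUnion_null (fun n => (hC n).2)]
      have h2 := hμ ∅ (fun _ => false)
      simp at h2 h1
      simp [h1] at h2
  · refine aux_tukey _ _ (fun y => {x | y ∉ φ x}) hψ ?_ ?_ ?_
    · intro x
      have : {y | x ∉ {x | y ∉ φ x}} = φ x := by ext y; simp
      rw [this]; exact hφ x
    · intro A hA B hB
      exact aux_gauge_down h A hA B hB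
    · exact aux_pos M hM0 hMsucc hM hpart hdist_adj hdist_nadj h hhval
end

section
/- With the Davies–Rogers construction data (graphs G_n, space Ω, metric ρ, gauge h as in the context), suppose for each n ∈ ω and each vertex a ∈ V(G_n) an independent subset H_n(a) ⊆ V(G_n) is given. Then for every x ∈ Ω, the set B_x = { y ∈ Ω : y(n) ∈ H_n(x(n)) for infinitely many n } has h-Hausdorff measure zero: H^h(B_x) = 0. -/
open Set ENNReal Finset Filter

theorem aux_approx {X : Type*} [MetricSpace X] (f : ℝ → ℝ) (hf : f 0 = 0) (δ : ℝ)
    (A : Set X) {ι : Type*} [Countable ι] (D : ι → Set X) (hA : A ⊆ ⋃ i, D i)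
    (hD : ∀ i, EMetric.diam (D i) ≤ ENNReal.ofReal δ) :
    hausdorffApprox f δ A ≤ ∑' i, ENNReal.ofReal (f (EMetric.diam (D i)).toReal) := by
  classical
  haveI := Encodable.ofCountable ι
  rw [← tsum_iUnion_decode₂ (fun S : Set X => ENNReal.ofReal (f (EMetric.diam S).toReal))
    (by simp [hf, show EMetric.diam (∅ : Set X) = 0 from Metric.ediam_empty]) D]
  unfold hausdorffApprox
  refine iInf_le_of_le (fun k => ⋃ b ∈ Encodable.decode₂ ι k, D b) (iInf_le_of_le ?_ (iInf_le_of_le ?_ le_rfl))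
  · rw [Encodable.iUnion_decode₂]; exact hA
  · intro n
    exact Encodable.iUnion_decode₂_cases (C := fun S => EMetric.diam S ≤ ENNReal.ofReal δ) (by simp [show EMetric.diam (∅ : Set X) = 0 from Metric.ediam_empty]) hD

/-- With the Davies–Rogers construction data, if for each `n` and each
vertex `a ∈ V (G n)` an independent set `Hf n a ⊆ V (G n)` is given, then for every `x ∈ Ω`
the set `B_x = { y ∈ Ω : y n ∈ Hf n (x n) for infinitely many n }` is `h`-Hausdorff null. -/
theorem statement13
    (V : ℕ → Type*) [∀ n, Fintype (V n)] [∀ n, Nonempty (V n)]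
    (G : ∀ n, SimpleGraph (V n))
    (M : ℕ → ℕ) (hM0 : M 0 = 1) (hMsucc : ∀ n, M (n + 1) = 2 * Fintype.card (V n))
    -- the metric ρ on Ω
    [MetricSpace (∀ n, V n)]
    (hdist_adj : ∀ x y : ∀ n, V n, ∀ n : ℕ, (∀ k, k < n → x k = y k) → x n ≠ y n →
      (G n).Adj (x n) (y n) → dist x y = (2 : ℝ) ^ (1 - (n : ℤ)))
    (hdist_nadj : ∀ x y : ∀ n, V n, ∀ n : ℕ, (∀ k, k < n → x k = y k) → x n ≠ y n →
      ¬ (G n).Adj (x n) (y n) → dist x y = (2 : ℝ) ^ (-(n : ℤ)))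
    -- the gauge function h
    (h : ℝ → ℝ) (hh0 : h 0 = 0)
    (hhval : ∀ n : ℕ,
      h ((2 : ℝ) ^ (-(n : ℤ))) = 1 / ∏ k ∈ Finset.range (n + 1), (M k : ℝ))
    (hlin : ∀ n : ℕ, ∀ t : ℝ, (2 : ℝ) ^ (-(n : ℤ) - 1) ≤ t → t ≤ (2 : ℝ) ^ (-(n : ℤ)) →
      h t = h ((2 : ℝ) ^ (-(n : ℤ) - 1)) +
        (t - (2 : ℝ) ^ (-(n : ℤ) - 1)) *
          (h ((2 : ℝ) ^ (-(n : ℤ))) - h ((2 : ℝ) ^ (-(n : ℤ) - 1))) /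
            ((2 : ℝ) ^ (-(n : ℤ)) - (2 : ℝ) ^ (-(n : ℤ) - 1)))
    (hone : ∀ t : ℝ, 1 ≤ t → h t = 1)
    -- a family of independent sets, one for each vertex of each graph
    (Hf : ∀ n, V n → Set (V n)) (hHf : ∀ n a, IsIndepSet (G n) (Hf n a)) :
    ∀ x : ∀ n, V n,
      hausdorffGauge h {y : ∀ n, V n | ∃ᶠ n in atTop, y n ∈ Hf n (x n)} = 0 := by
  intro x
  have hMpos : ∀ k, 1 ≤ M k := by
    intro k
    cases k with
    | zero => omega
    | succ k =>
      have := Fintype.card_pos (α := V k)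
      rw [hMsucc]; omega
  have hprodpos : ∀ n, (0 : ℝ) < ∏ k ∈ Finset.range n, (M k : ℝ) := fun n =>
    Finset.prod_pos fun k _ => by exact_mod_cast hMpos k
  have hstep : ∀ n : ℕ, h ((2 : ℝ) ^ (-((n + 1 : ℕ) : ℤ))) ≤ h ((2 : ℝ) ^ (-(n : ℤ))) := by
    intro n
    rw [hhval, hhval, Finset.prod_range_succ _ (n + 1)]
    apply one_div_le_one_div_of_le (hprodpos _)
    exact le_mul_of_one_le_right (hprodpos _).le (by exact_mod_cast hMpos _)
  have hanti : Antitone fun n : ℕ => h ((2 : ℝ) ^ (-(n : ℤ))) := antitone_nat_of_succ_le hstep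
  have hmono : ∀ (n : ℕ) (t : ℝ), 0 ≤ t → t ≤ (2 : ℝ) ^ (-(n : ℤ)) →
      h t ≤ h ((2 : ℝ) ^ (-(n : ℤ))) := by
    intro n t ht0 htn
    rcases ht0.eq_or_lt with rfl | ht
    · rw [hh0, hhval]
      exact (one_div_pos.2 (hprodpos _)).le
    have ht1 : t ≤ 1 := htn.trans (zpow_le_one_of_nonpos₀ (by norm_num) (by simp))
    obtain ⟨m, hm1, hm2⟩ := exists_nat_pow_near_of_lt_one ht ht1 (y := (1 / 2 : ℝ)) (by norm_num) (by norm_num)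
    have e : ∀ j : ℕ, (1 / 2 : ℝ) ^ j = (2 : ℝ) ^ (-(j : ℤ)) := by
      intro j; simp
    rw [e] at hm1 hm2
    have hnm : n ≤ m := by
      have := (zpow_lt_zpow_iff_right₀ (by norm_num : (1 : ℝ) < 2)).1 (hm1.trans_le htn)
      omega
    refine le_trans ?_ (hanti hnm)
    have e2 : (-((m + 1 : ℕ) : ℤ)) = -(m : ℤ) - 1 := by push_cast; ring
    have hs := hstep m
    rw [e2] at hm1 hs
    have hl := hlin m t hm1.le hm2
    have hd : (0 : ℝ) < (2 : ℝ) ^ (-(m : ℤ)) - (2 : ℝ) ^ (-(m : ℤ) - 1) :=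
      sub_pos.2 (hm1.trans_le hm2)
    have : (t - (2 : ℝ) ^ (-(m : ℤ) - 1)) *
          (h ((2 : ℝ) ^ (-(m : ℤ))) - h ((2 : ℝ) ^ (-(m : ℤ) - 1))) /
            ((2 : ℝ) ^ (-(m : ℤ)) - (2 : ℝ) ^ (-(m : ℤ) - 1)) ≤
          h ((2 : ℝ) ^ (-(m : ℤ))) - h ((2 : ℝ) ^ (-(m : ℤ) - 1)) := by
      rw [div_le_iff₀ hd, mul_comm]
      exact mul_le_mul_of_nonneg_left (by linarith) (by linarith)
    linarith
  have hprod : ∀ n : ℕ, ∏ k ∈ Finset.range (n + 1), (M k : ℝ) =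
      2 ^ n * (Fintype.card (∀ k : Fin n, V k) : ℝ) := by
    intro n
    rw [Finset.prod_range_succ', hM0, Fintype.card_pi]
    simp only [hMsucc]
    push_cast
    rw [Finset.prod_mul_distrib, Finset.prod_range (fun i => (Fintype.card (V i) : ℝ))]
    simp
  let D : ∀ n : ℕ, (∀ k : Fin n, V k) → Set (∀ n, V n) := fun n s =>
    {y | (∀ k : Fin n, y k = s k) ∧ y n ∈ Hf n (x n)}
  have hdiam : ∀ n s, EMetric.diam (D n s) ≤ ENNReal.ofReal ((2 : ℝ) ^ (-(n : ℤ))) := by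
    intro n s
    apply EMetric.diam_le
    rintro y ⟨hy, hyn⟩ z ⟨hz, hzn⟩
    rw [edist_dist]
    apply ENNReal.ofReal_le_ofReal
    by_cases hyz : y = z
    · rw [hyz, dist_self]; positivity
    classical
    have hex : ∃ k, y k ≠ z k := Function.ne_iff.1 hyz
    have hlt : ∀ k < Nat.find hex, y k = z k := fun k hk => not_not.1 (Nat.find_min hex hk)
    have hne := Nat.find_spec hex
    generalize Nat.find hex = m at hlt hne
    have hnm : n ≤ m := by
      by_contra hc
      push Not at hc
      exact hne ((hy ⟨m, hc⟩).trans (hz ⟨m, hc⟩).symm)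
    by_cases hadj : (G m).Adj (y m) (z m)
    · rw [hdist_adj y z m hlt hne hadj]
      have : n ≠ m := by
        rintro rfl
        exact hHf _ _ _ hyn _ hzn hadj
      exact zpow_le_zpow_right₀ (by norm_num) (by omega)
    · rw [hdist_nadj y z m hlt hne hadj]
      exact zpow_le_zpow_right₀ (by norm_num) (by omega)
  have hlevel : ∀ n : ℕ, ∑' s, ENNReal.ofReal (h (EMetric.diam (D n s)).toReal) ≤ 2⁻¹ ^ n := by
    intro n
    have hb : ∀ s, ENNReal.ofReal (h (EMetric.diam (D n s)).toReal) ≤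
        ENNReal.ofReal (1 / (2 ^ n * (Fintype.card (∀ k : Fin n, V k) : ℝ))) := by
      intro s
      apply ENNReal.ofReal_le_ofReal
      rw [← hprod, ← hhval]
      exact hmono n _ ENNReal.toReal_nonneg (ENNReal.toReal_le_of_le_ofReal (by positivity) (hdiam n s))
    rw [tsum_fintype]
    refine (Finset.sum_le_sum fun s _ => hb s).trans ?_
    rw [Finset.sum_const, nsmul_eq_mul, Finset.card_univ]
    have hc : (0 : ℝ) < (Fintype.card (∀ k : Fin n, V k) : ℝ) := by
      exact_mod_cast Fintype.card_pos
    rw [← ENNReal.ofReal_natCast, ← ENNReal.ofReal_mul (by positivity)]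
    have : (Fintype.card (∀ k : Fin n, V k) : ℝ) * (1 / (2 ^ n * (Fintype.card (∀ k : Fin n, V k) : ℝ)))
        = (2⁻¹) ^ n := by
      rw [inv_pow]
      field_simp
    rw [this, ENNReal.ofReal_pow (by positivity), ENNReal.ofReal_inv_of_pos (by norm_num)]
    simp
  unfold hausdorffGauge
  simp only [ENNReal.iSup_eq_zero]
  intro δ hδ
  obtain ⟨K0, hK0⟩ := exists_pow_lt_of_lt_one hδ (by norm_num : (1 / 2 : ℝ) < 1)
  have key : ∀ K ≥ K0, hausdorffApprox h δ {y : ∀ n, V n | ∃ᶠ n in atTop, y n ∈ Hf n (x n)} ≤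
      2 * 2⁻¹ ^ K := by
    intro K hK
    refine (aux_approx h hh0 δ _ (ι := Σ n : ℕ, ∀ k : Fin (n + K), V k)
      (fun i => D (i.1 + K) i.2) ?_ ?_).trans ?_
    · intro y hy
      obtain ⟨n, hn, hyn⟩ := (Filter.frequently_atTop.1 hy) K
      obtain ⟨j, rfl⟩ := Nat.exists_eq_add_of_le' hn
      exact Set.mem_iUnion.2 ⟨⟨j, fun k => y k⟩, fun _ => rfl, hyn⟩
    · rintro ⟨n, s⟩
      refine (hdiam _ _).trans (ENNReal.ofReal_le_ofReal (le_trans ?_ hK0.le))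
      have e : (1 / 2 : ℝ) ^ K0 = (2 : ℝ) ^ (-(K0 : ℤ)) := by simp
      rw [e]
      exact zpow_le_zpow_right₀ (by norm_num) (by push_cast; omega)
    · rw [ENNReal.tsum_sigma' (f := fun i : (Σ n : ℕ, ∀ k : Fin (n + K), V k) =>
        ENNReal.ofReal (h (EMetric.diam (D (i.1 + K) i.2)).toReal))]
      refine (ENNReal.tsum_le_tsum fun n => hlevel (n + K)).trans ?_
      simp_rw [pow_add]
      rw [ENNReal.tsum_mul_right, ENNReal.tsum_geometric, ENNReal.one_sub_inv_two, inv_inv]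
  have hlim : Tendsto (fun K : ℕ => (2 : ℝ≥0∞) * 2⁻¹ ^ K) atTop (nhds 0) := by
    have := ENNReal.Tendsto.const_mul (a := 2)
      (ENNReal.tendsto_pow_atTop_nhds_zero_of_lt_one (r := 2⁻¹) (by simp)) (Or.inr (by simp))
    simpa using this
  exact le_antisymm (ge_of_tendsto hlim (eventually_atTop.2 ⟨K0, key⟩)) bot_le
end

section
/- Let a, e ∈ ω^ω with 0 < e(n) ≤ a(n) for all n and Π_{n∈ω} e(n)/a(n) = 0 (i.e. the partial products converge to 0). Then cov(E) ≤ 𝔠^∀_{a,e}. -/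
open Set Filter Finset ENNReal

/-- `𝔠^∀_{a,e}`: the least cardinality of a family `S` of slaloms in
`S(a, e) = Π_n [a n]^{≤ e n}` such that every `x ∈ Π_n a n` is caught by some `φ ∈ S` at all
but finitely many coordinates. -/
noncomputable def cForall (a e : ℕ → ℕ) : Cardinal :=
  sInf {κ : Cardinal | ∃ S : Set (∀ n, Finset (Fin (a n))),
    (∀ φ ∈ S, ∀ n, (φ n).card ≤ e n) ∧
    (∀ x : ∀ n, Fin (a n), ∃ φ ∈ S, ∀ᶠ n in atTop, x n ∈ φ n) ∧
    κ = Cardinal.mk S}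

noncomputable def rr (z : ℕ → Bool) : ℝ := Real.ofDigits (b := 2) (fun i => if z i then 1 else 0)

def ss (z : ℕ → Bool) : ℕ → ℕ
  | 0 => 0
  | k + 1 => 2 * ss z k + (if z k then 1 else 0)

lemma ss_inj (z w : ℕ → Bool) (k : ℕ) (h : ss z k = ss w k) : ∀ i < k, z i = w i := by
  induction k with
  | zero => intro i hi; omega
  | succ k ih =>
    simp only [ss] at h
    intro i hi
    have h1 : ss z k = ss w k := by split_ifs at h <;> omega
    have h2 : z k = w k := by
      cases hz : z k <;> cases hw : w k <;> simp [hz, hw] at h ⊢ <;> omega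
    rcases Nat.lt_succ_iff_lt_or_eq.mp hi with h3 | h3
    · exact ih h1 i h3
    · rw [h3]; exact h2

lemma rr_cont : Continuous rr := by
  unfold rr
  refine Real.continuous_ofDigits.comp ?_
  refine continuous_pi fun i => ?_
  exact (continuous_of_discreteTopology (f := fun b : Bool => if b then (1 : Fin 2) else 0)).comp
    (continuous_apply i)

lemma rr_nonneg (z) : 0 ≤ rr z := Real.ofDigits_nonneg _
lemma rr_le_one (z) : rr z ≤ 1 := Real.ofDigits_le_one _

lemma ss_eq (z : ℕ → Bool) (k : ℕ) :
    (2:ℝ)^k * rr z = ss z k + rr (fun i => z (i + k)) := by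
  have key : ∀ w : ℕ → Bool, 2 * rr w = (if w 0 then 1 else 0) + rr (fun i => w (i + 1)) := by
    intro w
    have := Real.ofDigits_eq_sum_add_ofDigits (b := 2) (fun i => if w i then 1 else 0) 1
    unfold rr
    rw [this]
    simp [Real.ofDigitsTerm]
    split_ifs <;> simp <;> ring
  induction k with
  | zero => simp [ss]
  | succ k ih =>
    have h2 := key (fun i => z (i + k))
    simp only [zero_add] at h2
    have : (fun i => z (i + 1 + k)) = (fun i => z (i + (k + 1))) := by
      funext i; congr 1; omega
    rw [this] at h2
    rw [pow_succ, ss]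
    push_cast
    linear_combination 2 * ih + h2

lemma meas_interval (μ : MeasureTheory.Measure (ℕ → Bool))
    (hμ : ∀ (s : Finset ℕ) (y : ℕ → Bool),
      μ {x : ℕ → Bool | ∀ i ∈ s, x i = y i} = (1 / 2 : ℝ≥0∞) ^ s.card) (P N : ℕ) (hP : 0 < P) :
    μ {z | (N:ℝ) ≤ P * rr z ∧ P * rr z ≤ N + 1} ≤ ENNReal.ofReal (6 / P) := by
  set k := Nat.log 2 P
  have hk1 : 2 ^ k ≤ P := Nat.pow_log_le_self 2 hP.ne'
  have hk2 : P < 2 ^ (k + 1) := Nat.lt_pow_succ_log_self (by norm_num) P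
  have hk1' : (2:ℝ) ^ k ≤ P := by exact_mod_cast hk1
  have hk2' : (P:ℝ) < 2 ^ (k + 1) := by exact_mod_cast hk2
  have hP' : (0:ℝ) < P := by exact_mod_cast hP
  set t : ℝ := 2 ^ k * N / P with ht
  have ht0 : 0 ≤ t := by positivity
  set j := ⌊t⌋₊
  have hj1 : (j:ℝ) ≤ t := Nat.floor_le ht0
  have hj2 : t < j + 1 := Nat.lt_floor_add_one t
  have hsub : {z | (N:ℝ) ≤ P * rr z ∧ P * rr z ≤ N + 1} ⊆
      ⋃ q ∈ Finset.Icc (j - 1) (j + 1), {z | ss z k = q} := by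
    rintro z ⟨h1, h2⟩
    have e1 := ss_eq z k
    have e2 := rr_nonneg (fun i => z (i + k))
    have e3 := rr_le_one (fun i => z (i + k))
    have f1 : t ≤ 2 ^ k * rr z := by
      rw [ht, div_le_iff₀ hP']
      nlinarith [pow_pos (two_pos : (0:ℝ) < 2) k]
    have f2 : 2 ^ k * rr z ≤ t + 1 := by
      have : t + 1 = (2 ^ k * N + P) / P := by rw [ht]; field_simp
      rw [this, le_div_iff₀ hP']
      nlinarith [pow_pos (two_pos : (0:ℝ) < 2) k]
    have g1 : (j:ℝ) ≤ (ss z k + 1 : ℕ) := by push_cast; linarith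
    have g2 : (ss z k : ℝ) < (j + 2 : ℕ) := by push_cast; linarith
    have g1 := Nat.cast_le.mp g1
    have g2 := Nat.cast_lt.mp g2
    simp only [Set.mem_iUnion, Finset.mem_Icc, Set.mem_setOf_eq]
    exact ⟨ss z k, ⟨by omega, by omega⟩, rfl⟩
  have hcyl : ∀ q, μ {z | ss z k = q} ≤ (1/2 : ℝ≥0∞) ^ k := by
    intro q
    by_cases hq : ∃ w, ss w k = q
    · obtain ⟨w, hw⟩ := hq
      have := hμ (Finset.range k) w
      rw [Finset.card_range] at this
      rw [← this]
      apply MeasureTheory.measure_mono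
      intro z hz i hi
      exact ss_inj z w k (by rw [hw]; exact hz) i (Finset.mem_range.mp hi)
    · have : {z | ss z k = q} = ∅ := by
        ext z; simp; exact fun h => hq ⟨z, h⟩
      rw [this]; simp
  calc _ ≤ μ (⋃ q ∈ Finset.Icc (j - 1) (j + 1), {z | ss z k = q}) :=
        MeasureTheory.measure_mono hsub
    _ ≤ ∑ q ∈ Finset.Icc (j - 1) (j + 1), μ {z | ss z k = q} :=
        MeasureTheory.measure_biUnion_finset_le _ _
    _ ≤ ∑ q ∈ Finset.Icc (j - 1) (j + 1), (1/2 : ℝ≥0∞) ^ k := Finset.sum_le_sum fun q _ => hcyl q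
    _ ≤ 3 * (1/2 : ℝ≥0∞) ^ k := by
        rw [Finset.sum_const, nsmul_eq_mul]
        gcongr
        rw [Nat.card_Icc]
        exact_mod_cast (by omega : j + 1 + 1 - (j - 1) ≤ 3)
    _ = ENNReal.ofReal (3 * (1/2)^k) := by
        rw [ENNReal.ofReal_mul (by norm_num), ENNReal.ofReal_pow (by norm_num),
          ENNReal.ofReal_div_of_pos (by norm_num)]
        simp
    _ ≤ _ := by
        apply ENNReal.ofReal_le_ofReal
        rw [le_div_iff₀ hP', one_div, inv_pow]
        rw [pow_succ] at hk2'
        have : (0:ℝ) < 2 ^ k := by positivity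
        rw [mul_assoc, inv_mul_eq_div]
        have : (P:ℝ) / 2^k ≤ 2 := by rw [div_le_iff₀ this]; linarith
        linarith

def TT (a : ℕ → ℕ) (φ : ∀ n, Finset (Fin (a n))) (m : ℕ) : ℕ → Finset ℕ
  | 0 => Finset.range (∏ k ∈ Finset.range m, a k + 1)
  | j + 1 => (TT a φ m j ×ˢ φ (m + j)).image (fun p => p.1 * a (m + j) + p.2)

lemma TT_card (a e : ℕ → ℕ) (φ : ∀ n, Finset (Fin (a n))) (hφ : ∀ n, (φ n).card ≤ e n) (m j : ℕ) :
    (TT a φ m j).card ≤ (∏ k ∈ Finset.range m, a k + 1) * ∏ k ∈ Finset.range j, e (m + k) := by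
  induction j with
  | zero => simp [TT]
  | succ j ih =>
    rw [TT, Finset.prod_range_succ, ← mul_assoc]
    refine Finset.card_image_le.trans ?_
    rw [Finset.card_product]
    exact Nat.mul_le_mul ih (hφ _)

def CC (a : ℕ → ℕ) (φ : ∀ n, Finset (Fin (a n))) (m : ℕ) : Set (ℕ → Bool) :=
  ⋂ j, ⋃ N ∈ TT a φ m j, {z | (N:ℝ) ≤ (∏ k ∈ Finset.range (m + j), a k : ℕ) * rr z ∧
    (∏ k ∈ Finset.range (m + j), a k : ℕ) * rr z ≤ N + 1}

lemma CC_closed (a φ m) : IsClosed (CC a φ m) := by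
  refine isClosed_iInter fun j => ?_
  refine Set.Finite.isClosed_biUnion (Finset.finite_toSet _) fun N _ => ?_
  have := rr_cont
  have hc : Continuous fun z => ((∏ k ∈ Finset.range (m + j), a k : ℕ) : ℝ) * rr z :=
    continuous_const.mul this
  exact (isClosed_le continuous_const hc).inter (isClosed_le hc continuous_const)

lemma CC_null (a e : ℕ → ℕ) (hepos : ∀ n, 0 < e n) (hea : ∀ n, e n ≤ a n)
    (hprod : Tendsto (fun n : ℕ => ∏ k ∈ Finset.range n, ((e k : ℝ) / (a k : ℝ)))
      atTop (nhds 0))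
    (μ : MeasureTheory.Measure (ℕ → Bool))
    (hμ : ∀ (s : Finset ℕ) (y : ℕ → Bool),
      μ {x : ℕ → Bool | ∀ i ∈ s, x i = y i} = (1 / 2 : ℝ≥0∞) ^ s.card)
    (φ : ∀ n, Finset (Fin (a n))) (hφ : ∀ n, (φ n).card ≤ e n) (m : ℕ) : μ (CC a φ m) = 0 := by
  set M : ℕ := ∏ k ∈ Finset.range m, a k + 1
  have bound : ∀ j, μ (CC a φ m) ≤
      ENNReal.ofReal (6 * M * ∏ k ∈ Finset.range (j + m), ((e k : ℝ) / (a k : ℝ))) := by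
    intro j
    rw [add_comm j m]
    set P := ∏ k ∈ Finset.range (m + j), a k with hPdef
    have hP : 0 < P := Finset.prod_pos fun k _ => (hepos k).trans_le (hea k)
    have hP' : (0:ℝ) < P := by exact_mod_cast hP
    have hcard : (TT a φ m j).card ≤ M * ∏ k ∈ Finset.range (m + j), e k := by
      refine (TT_card a e φ hφ m j).trans ?_
      rw [Finset.prod_range_add]
      refine Nat.mul_le_mul le_rfl (Nat.le_mul_of_pos_left _ ?_)
      exact Finset.prod_pos fun k _ => hepos k
    calc _ ≤ μ (⋃ N ∈ TT a φ m j, {z | (N:ℝ) ≤ P * rr z ∧ P * rr z ≤ N + 1}) :=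
          MeasureTheory.measure_mono (Set.iInter_subset _ j)
      _ ≤ ∑ N ∈ TT a φ m j, μ {z | (N:ℝ) ≤ P * rr z ∧ P * rr z ≤ N + 1} :=
          MeasureTheory.measure_biUnion_finset_le _ _
      _ ≤ ∑ N ∈ TT a φ m j, ENNReal.ofReal (6 / P) :=
          Finset.sum_le_sum fun N _ => meas_interval μ hμ P N hP
      _ = ENNReal.ofReal ((TT a φ m j).card * (6 / P)) := by
          rw [Finset.sum_const, nsmul_eq_mul, ENNReal.ofReal_mul (by positivity),
            ENNReal.ofReal_natCast]
      _ ≤ _ := by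
          apply ENNReal.ofReal_le_ofReal
          rw [Finset.prod_div_distrib, ← Nat.cast_prod, ← Nat.cast_prod, ← hPdef]
          have : ((TT a φ m j).card : ℝ) ≤ M * (∏ k ∈ Finset.range (m + j), e k : ℕ) := by
            exact_mod_cast hcard
          calc _ ≤ (M * (∏ k ∈ Finset.range (m + j), e k : ℕ) : ℝ) * (6 / P) := by gcongr
            _ = _ := by ring
  have lim : Tendsto (fun j => ENNReal.ofReal
      (6 * M * ∏ k ∈ Finset.range (j + m), ((e k : ℝ) / (a k : ℝ)))) atTop (nhds 0) := by
    have h1 := ((tendsto_add_atTop_iff_nat m).mpr hprod).const_mul (6 * (M:ℝ))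
    have h2 := ENNReal.tendsto_ofReal h1
    simpa using h2
  exact le_antisymm (ge_of_tendsto' lim bound) zero_le

noncomputable def xx (a : ℕ → ℕ) (ha : ∀ n, 0 < a n) (z : ℕ → Bool) (n : ℕ) : Fin (a n) :=
  ⟨⌊((∏ k ∈ Finset.range (n + 1), a k : ℕ) : ℝ) * rr z⌋₊ % a n, Nat.mod_lt _ (ha n)⟩

lemma mem_CC (a : ℕ → ℕ) (ha : ∀ n, 0 < a n) (φ : ∀ n, Finset (Fin (a n))) (z : ℕ → Bool) (m : ℕ)
    (h : ∀ n, m ≤ n → xx a ha z n ∈ φ n) : z ∈ CC a φ m := by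
  have key : ∀ j, ⌊((∏ k ∈ Finset.range (m + j), a k : ℕ) : ℝ) * rr z⌋₊ ∈ TT a φ m j := by
    intro j
    induction j with
    | zero =>
      rw [TT, Finset.mem_range, Nat.lt_succ_iff]
      apply Nat.floor_le_of_le
      exact mul_le_of_le_one_right (Nat.cast_nonneg _) (rr_le_one z)
    | succ j ih =>
      rw [TT, Finset.mem_image]
      refine ⟨(_, xx a ha z (m + j)), Finset.mem_product.mpr ⟨ih, h _ (by omega)⟩, ?_⟩
      have h0 : (a (m + j) : ℝ) ≠ 0 := by exact_mod_cast (ha _).ne'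
      have : ((∏ k ∈ Finset.range (m + j), a k : ℕ) : ℝ) * rr z =
          ((∏ k ∈ Finset.range (m + j + 1), a k : ℕ) : ℝ) * rr z / (a (m + j) : ℕ) := by
        rw [Finset.prod_range_succ]; push_cast; field_simp
      change ⌊_⌋₊ * a (m + j) + ⌊_⌋₊ % a (m + j) = _
      rw [this, Nat.floor_div_natCast, ← add_assoc]
      exact Nat.div_add_mod' _ _
  refine Set.mem_iInter.mpr fun j => ?_
  refine Set.mem_biUnion (key j) ⟨Nat.floor_le ?_, (Nat.lt_floor_add_one _).le⟩
  exact mul_nonneg (Nat.cast_nonneg _) (rr_nonneg z)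

theorem statement14 (a e : ℕ → ℕ) (hepos : ∀ n, 0 < e n) (hea : ∀ n, e n ≤ a n)
    (hprod : Tendsto (fun n : ℕ => ∏ k ∈ Finset.range n, ((e k : ℝ) / (a k : ℝ)))
      atTop (nhds 0))
    (μ : MeasureTheory.Measure (ℕ → Bool))
    (hμ : ∀ (s : Finset ℕ) (y : ℕ → Bool),
      μ {x : ℕ → Bool | ∀ i ∈ s, x i = y i} = (1 / 2 : ℝ≥0∞) ^ s.card) :
    covIdeal (closedNullIdeal μ) ≤ cForall a e := by
  unfold cForall
  apply le_csInf
  · refine ⟨_, {φ | ∀ n, (φ n).card ≤ e n}, fun φ h => h, fun x => ?_, rfl⟩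
    refine ⟨fun n => {x n}, fun n => ?_, ?_⟩
    · rw [Finset.card_singleton]; exact hepos n
    · simp
  · rintro κ ⟨S, hS, hcov, rfl⟩
    have ha : ∀ n, 0 < a n := fun n => (hepos n).trans_le (hea n)
    refine le_trans (csInf_le' ?_) (Cardinal.mk_image_le (f := fun φ => ⋃ m, CC a φ m) (s := S))
    refine ⟨_, ?_, ?_, rfl⟩
    · rintro _ ⟨φ, hφ, rfl⟩
      exact ⟨CC a φ, fun m => ⟨CC_closed a φ m,
        CC_null a e hepos hea hprod μ hμ φ (hS φ hφ) m⟩, le_rfl⟩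
    · refine Set.eq_univ_of_forall fun z => ?_
      obtain ⟨φ, hφ, hev⟩ := hcov (xx a ha z)
      obtain ⟨m, hm⟩ := eventually_atTop.mp hev
      exact ⟨_, ⟨φ, hφ, rfl⟩, Set.mem_iUnion.mpr ⟨m, mem_CC a ha φ z m hm⟩⟩
end
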